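/- arXiv:2605.23884 — 4 statements merged into one kernel-verified Lean document; each statement's English description precedes it below -/
import Mathlib

section
/- Let μ be a tempered measure on ℝ^d. Then the distributional Fourier transform μ̂ is a strongly almost periodic measure if and only if μ̂ is a translation-bounded measure and μ is a pure-point measure. (Here the assertion that μ̂ is a strongly almost periodic measure, resp. a translation-bounded measure, includes the assertion that μ̂ agrees with a measure.) -/
set_option linter.unusedSectionVars false

open MeasureTheory Filter Metric Complex SchwartzMap
open scoped Topology ENNReal NNReal ComplexConjugate

noncomputable section

section Preamble

variable {E : Type*} [NormedAddCommGroup E] [InnerProductSpace ℝ E] [FiniteDimensional ℝ E]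
  [MeasurableSpace E] [BorelSpace E]

/-- A set is relatively dense if it has bounded gaps. -/
def IsRelativelyDense (A : Set E) : Prop :=
  ∃ r : ℝ, ∀ x : E, ∃ a ∈ A, dist x a ≤ r

/-- Bohr almost periodic functions: uniformly continuous, bounded, with relatively
dense sets of ε-almost periods. -/
def IsBohrAP (f : E → ℂ) : Prop :=
  UniformContinuous f ∧ (∃ C : ℝ, ∀ x, ‖f x‖ ≤ C) ∧
    ∀ ε : ℝ, 0 < ε → IsRelativelyDense {t : E | ∀ x, ‖f (x - t) - f x‖ < ε}

/-- Bounded functions. -/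
def IsBddFun (f : E → ℂ) : Prop := ∃ C : ℝ, ∀ x, ‖f x‖ ≤ C

lemma isometry_const_sub (x : E) : Isometry (fun y : E => x - y) :=
  Isometry.of_dist_eq (fun a b => dist_sub_left x a b)

lemma hasTemperateGrowth_const_sub (x : E) :
    Function.HasTemperateGrowth (fun y : E => x - y) := by
  apply Function.HasTemperateGrowth.of_fderiv (k := 1) (C := ‖x‖ + 1)
  · have h : (fderiv ℝ (fun y : E => x - y)) =
        fun _ : E => ((0 : E →L[ℝ] E) - ContinuousLinearMap.id ℝ E) := by
      funext y
      exact ((hasFDerivAt_const x y).sub (hasFDerivAt_id y)).fderiv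
    rw [h]
    exact Function.HasTemperateGrowth.const _
  · exact (differentiable_const x).sub differentiable_id
  · intro y
    have h1 : ‖x - y‖ ≤ ‖x‖ + ‖y‖ := norm_sub_le x y
    have h2 : (0:ℝ) ≤ ‖x‖ := norm_nonneg x
    have h3 : (0:ℝ) ≤ ‖y‖ := norm_nonneg y
    calc ‖x - y‖ ≤ ‖x‖ + ‖y‖ := h1
      _ ≤ (‖x‖ + 1) * (1 + ‖y‖) ^ 1 := by nlinarith

/-- The reflected translate `y ↦ ψ (x - y)` of a Schwartz function. -/
def transRefl (x : E) (ψ : SchwartzMap E ℂ) : SchwartzMap E ℂ :=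
  SchwartzMap.compCLMOfAntilipschitz (K := 1) ℝ (hasTemperateGrowth_const_sub x)
    (isometry_const_sub x).antilipschitz ψ

@[simp] lemma transRefl_apply (x : E) (ψ : SchwartzMap E ℂ) (y : E) :
    transRefl x ψ y = ψ (x - y) := rfl

/-- Convolution of a tempered distribution with a Schwartz function:
`(T * ψ)(x) = T (ψ (x - ·))`. -/
def convTD (T : SchwartzMap E ℂ →L[ℂ] ℂ) (ψ : SchwartzMap E ℂ) : E → ℂ :=
  fun x => T (transRefl x ψ)

/-- Smooth compactly supported test function, regarded inside the Schwartz space. -/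
def IsTestFn (φ : SchwartzMap E ℂ) : Prop := HasCompactSupport ⇑φ

/-- Translation bounded as a tempered distribution. -/
def TransBddTD (T : SchwartzMap E ℂ →L[ℂ] ℂ) : Prop :=
  ∀ ψ : SchwartzMap E ℂ, IsBddFun (convTD T ψ)

/-- Translation bounded as a distribution. -/
def TransBddD (T : SchwartzMap E ℂ →L[ℂ] ℂ) : Prop :=
  ∀ ψ : SchwartzMap E ℂ, IsTestFn ψ → IsBddFun (convTD T ψ)

/-- Strongly almost periodic as a tempered distribution. -/
def SAPTD (T : SchwartzMap E ℂ →L[ℂ] ℂ) : Prop :=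
  ∀ ψ : SchwartzMap E ℂ, IsBohrAP (convTD T ψ)

/-- Strongly almost periodic as a distribution. -/
def SAPD (T : SchwartzMap E ℂ →L[ℂ] ℂ) : Prop :=
  ∀ ψ : SchwartzMap E ℂ, IsTestFn ψ → IsBohrAP (convTD T ψ)

/-- The distributional Fourier transform, `T̂(φ) = T(φ̂)`, with the convention
`φ̂(ξ) = ∫ e^{-2πi⟨x,ξ⟩} φ(x) dx`. -/
def fourierTD (T : SchwartzMap E ℂ →L[ℂ] ℂ) : SchwartzMap E ℂ →L[ℂ] ℂ :=
  T.comp (SchwartzMap.fourierTransformCLM ℂ)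

/-- A complex Radon measure, encoded by its total variation measure together with a
unimodular density (polar decomposition). -/
structure CMeasure (E : Type*) [TopologicalSpace E] [MeasurableSpace E] where
  /-- the total variation measure -/
  tv : Measure E
  locFin : IsLocallyFiniteMeasure tv
  /-- the unimodular density -/
  density : E → ℂ
  density_meas : Measurable density
  density_norm : ∀ᵐ x ∂tv, ‖density x‖ = 1

namespace CMeasure

/-- Pairing of a complex measure with a function: `μ(φ) = ∫ φ dμ`. -/
def pairing (μ : CMeasure E) (φ : E → ℂ) : ℂ := ∫ x, φ x * μ.density x ∂μ.tv

/-- The complex measure agrees with the tempered distribution `T` on all smooth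
compactly supported test functions; i.e. `μ` is a tempered measure identified with `T`. -/
def Agrees (μ : CMeasure E) (T : SchwartzMap E ℂ →L[ℂ] ℂ) : Prop :=
  ∀ φ : SchwartzMap E ℂ, IsTestFn φ → T φ = μ.pairing ⇑φ

/-- A tempered measure is one that extends to a tempered distribution. -/
def IsTempered (μ : CMeasure E) : Prop := ∃ T, μ.Agrees T

/-- Pure point measure: concentrated on a countable set. -/
def IsPurePoint (μ : CMeasure E) : Prop := ∃ S : Set E, S.Countable ∧ μ.tv Sᶜ = 0

/-- Convolution of a complex measure with a function: `(μ * φ)(x) = ∫ φ(x - y) dμ(y)`. -/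
def convM (μ : CMeasure E) (φ : E → ℂ) : E → ℂ :=
  fun x => ∫ y, φ (x - y) * μ.density y ∂μ.tv

/-- Translation bounded as a measure. -/
def TransBddM (μ : CMeasure E) : Prop :=
  ∀ φ : E → ℂ, Continuous φ → HasCompactSupport φ → IsBddFun (μ.convM φ)

/-- Strongly almost periodic as a measure. -/
def SAPM (μ : CMeasure E) : Prop :=
  ∀ φ : E → ℂ, Continuous φ → HasCompactSupport φ → IsBohrAP (μ.convM φ)

/-- Strongly tempered measure: the total variation has polynomial growth,
equivalently `|μ|` is a tempered (slowly increasing) measure. -/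
def IsStronglyTempered (μ : CMeasure E) : Prop :=
  ∃ C a : ℝ, ∀ r : ℝ, 1 ≤ r → μ.tv (Metric.closedBall 0 r) ≤ ENNReal.ofReal (C * r ^ a)

/-- The atom of a complex measure at a point: `μ({x})`. -/
def atom (μ : CMeasure E) (x : E) : ℂ := (μ.tv {x}).toReal • μ.density x

/-- The measure is concentrated on a locally finite set. -/
def LocallyFiniteSupport (μ : CMeasure E) : Prop :=
  ∃ S : Set E, (∀ K : Set E, IsCompact K → (S ∩ K).Finite) ∧ μ.tv Sᶜ = 0

end CMeasure

end Preamble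

section Work
variable {E : Type*} [NormedAddCommGroup E] [InnerProductSpace ℝ E] [FiniteDimensional ℝ E]
  [MeasurableSpace E] [BorelSpace E]

/-- Uniformly continuous with totally bounded set of translates. -/
def TB (f : E → ℂ) : Prop :=
  UniformContinuous f ∧ ∀ ε : ℝ, 0 < ε → ∃ F : Finset E, ∀ t : E, ∃ s ∈ F,
    ∀ x, ‖f (x - t) - f (x - s)‖ ≤ ε

lemma TB.of_bohr {f : E → ℂ} (h : IsBohrAP f) : TB f := by
  refine ⟨h.1, fun ε hε => ?_⟩
  obtain ⟨r, hr⟩ := h.2.2 (ε / 2) (by positivity)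
  obtain ⟨δ, hδ, hδ'⟩ := Metric.uniformContinuous_iff.1 h.1 (ε / 2) (by positivity)
  obtain ⟨F, -, hF, hFc⟩ := Metric.totallyBounded_iff.1
    (isCompact_closedBall (0 : E) r).totallyBounded δ hδ |>.imp (fun F hF =>
      (⟨trivial, hF.1, hF.2⟩ : True ∧ F.Finite ∧ _))
  refine ⟨hF.toFinset, fun t => ?_⟩
  obtain ⟨a, ha, hat⟩ := hr t
  have hmem : t - a ∈ closedBall (0 : E) r := by
    simpa [dist_eq_norm] using hat
  obtain ⟨s, hs, hs'⟩ := Set.mem_iUnion₂.1 (hFc hmem)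
  refine ⟨s, by simpa using hs, fun x => ?_⟩
  have h1 := ha (x - (t - a))
  have e : x - (t - a) - a = x - t := by abel
  rw [e] at h1
  have h2 : dist (f (x - (t - a))) (f (x - s)) < ε / 2 := by
    apply hδ'
    rw [dist_sub_left]
    exact hs'
  rw [dist_eq_norm] at h2
  calc ‖f (x - t) - f (x - s)‖ = ‖(f (x - t) - f (x - (t - a))) +
        (f (x - (t - a)) - f (x - s))‖ := by congr 1; ring
    _ ≤ _ := norm_add_le _ _
    _ ≤ ε := by linarith

lemma TB.bohr {f : E → ℂ} (h : TB f) (hb : IsBddFun f) : IsBohrAP f := by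
  refine ⟨h.1, hb, fun ε hε => ?_⟩
  obtain ⟨F, hF⟩ := h.2 (ε / 2) (by positivity)
  obtain ⟨r, hr⟩ := F.finite_toSet.isBounded.exists_norm_le
  refine ⟨r, fun t => ?_⟩
  obtain ⟨s, hs, hs'⟩ := hF t
  refine ⟨t - s, fun x => ?_, ?_⟩
  · have := hs' (x + s)
    have e1 : x + s - t = x - (t - s) := by abel
    have e2 : x + s - s = x := by abel
    rw [e1, e2] at this
    linarith
  · have : t - (t - s) = s := by abel
    rw [dist_eq_norm, this]
    exact hr s hs

lemma TB.add {f g : E → ℂ} (hf : TB f) (hg : TB g) : TB (fun x => f x + g x) := by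
  classical
  refine ⟨hf.1.add hg.1, fun ε hε => ?_⟩
  obtain ⟨F, hF⟩ := hf.2 (ε / 4) (by positivity)
  obtain ⟨G, hG⟩ := hg.2 (ε / 4) (by positivity)
  choose a ha ha' using hF
  choose b hb hb' using hG
  let P : E × E → Prop := fun p => ∃ t, (a t, b t) = p
  let c : E × E → E := fun p => if h : P p then h.choose else 0
  refine ⟨(F ×ˢ G).image c, fun t => ?_⟩
  have hP : P (a t, b t) := ⟨t, rfl⟩
  have hc : (a (c (a t, b t)), b (c (a t, b t))) = (a t, b t) := by
    have := hP.choose_spec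
    simp only [c, dif_pos hP]
    exact this
  refine ⟨c (a t, b t), Finset.mem_image_of_mem _ (Finset.mk_mem_product (ha t) (hb t)),
    fun x => ?_⟩
  set s := c (a t, b t)
  have e1 : a s = a t := congrArg Prod.fst hc
  have e2 : b s = b t := congrArg Prod.snd hc
  have h1 := ha' t x
  have h2 := hb' t x
  have h3 := ha' s x
  have h4 := hb' s x
  rw [e1] at h3
  rw [e2] at h4
  calc ‖(f (x - t) + g (x - t)) - (f (x - s) + g (x - s))‖
      = ‖((f (x - t) - f (x - a t)) - (f (x - s) - f (x - a t))) +
        ((g (x - t) - g (x - b t)) - (g (x - s) - g (x - b t)))‖ := by congr 1; ring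
    _ ≤ (‖f (x - t) - f (x - a t)‖ + ‖f (x - s) - f (x - a t)‖) +
        (‖g (x - t) - g (x - b t)‖ + ‖g (x - s) - g (x - b t)‖) :=
        (norm_add_le _ _).trans (add_le_add (norm_sub_le _ _) (norm_sub_le _ _))
    _ ≤ ε := by linarith

lemma TB.of_approx {f : E → ℂ}
    (h : ∀ ε : ℝ, 0 < ε → ∃ g, TB g ∧ ∀ x, ‖f x - g x‖ ≤ ε) : TB f := by
  constructor
  · rw [Metric.uniformContinuous_iff]
    intro ε hε
    obtain ⟨g, hg, hfg⟩ := h (ε / 4) (by positivity)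
    obtain ⟨δ, hδ, hδ'⟩ := Metric.uniformContinuous_iff.1 hg.1 (ε / 4) (by positivity)
    refine ⟨δ, hδ, fun {x y} hxy => ?_⟩
    have h1 := hfg x
    have h2 := hfg y
    have h3 := hδ' hxy
    rw [dist_eq_norm] at h3 ⊢
    calc ‖f x - f y‖ = ‖(f x - g x) - (f y - g y) + (g x - g y)‖ := by congr 1; ring
      _ ≤ ‖f x - g x‖ + ‖f y - g y‖ + ‖g x - g y‖ :=
        (norm_add_le _ _).trans (add_le_add (norm_sub_le _ _) le_rfl)
      _ < ε := by linarith
  · intro ε hε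
    obtain ⟨g, hg, hfg⟩ := h (ε / 4) (by positivity)
    obtain ⟨F, hF⟩ := hg.2 (ε / 4) (by positivity)
    refine ⟨F, fun t => ?_⟩
    obtain ⟨s, hs, hs'⟩ := hF t
    refine ⟨s, hs, fun x => ?_⟩
    have h1 := hfg (x - t)
    have h2 := hfg (x - s)
    have h3 := hs' x
    calc ‖f (x - t) - f (x - s)‖ = ‖(f (x - t) - g (x - t)) - (f (x - s) - g (x - s)) +
          (g (x - t) - g (x - s))‖ := by congr 1; ring
      _ ≤ ‖f (x - t) - g (x - t)‖ + ‖f (x - s) - g (x - s)‖ + ‖g (x - t) - g (x - s)‖ :=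
        (norm_add_le _ _).trans (add_le_add (norm_sub_le _ _) le_rfl)
      _ ≤ ε := by linarith

lemma TB.zero : TB (fun _ : E => (0 : ℂ)) :=
  ⟨uniformContinuous_const, fun ε hε => ⟨{0}, fun t => ⟨0, by simp, fun x => by simp [hε.le]⟩⟩⟩

/-- The character `x ↦ e(-⟪ξ, x⟫)`. -/
def ch (ξ x : E) : ℂ := (Real.fourierChar (-(inner ℝ ξ x)) : ℂ)

lemma norm_ch (ξ x : E) : ‖ch ξ x‖ = 1 := Circle.norm_coe _

lemma ch_sub (ξ x y : E) : ch ξ (x - y) = ch ξ x * conj (ch ξ y) := by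
  simp only [ch]
  rw [← Circle.coe_inv_eq_conj, ← Circle.coe_mul, ← AddChar.map_neg_eq_inv,
    ← AddChar.map_add_eq_mul, inner_sub_right]
  congr 2; ring

lemma continuous_ch : Continuous (fun p : E × E => ch p.1 p.2) := by
  unfold ch
  have : Continuous (fun t : ℝ => (Real.fourierChar t : ℂ)) := by fun_prop
  exact this.comp (by fun_prop)

lemma continuous_ch_left (x : E) : Continuous (fun ξ : E => ch ξ x) :=
  continuous_ch.comp (by fun_prop : Continuous fun ξ : E => (ξ, x))

lemma continuous_ch_right (ξ : E) : Continuous (fun x : E => ch ξ x) :=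
  continuous_ch.comp (by fun_prop : Continuous fun x : E => (ξ, x))

lemma TB.ch (ξ : E) (c : ℂ) : TB (fun x => c * ch ξ x) := by
  have key : ∀ x t s : E, ‖c * _root_.ch ξ (x - t) - c * _root_.ch ξ (x - s)‖ =
      ‖c‖ * ‖_root_.ch ξ t - _root_.ch ξ s‖ := by
    intro x t s
    rw [← mul_sub, ch_sub, ch_sub, ← mul_sub, ← map_sub, norm_mul, norm_mul, norm_ch,
      RCLike.norm_conj, one_mul]
  constructor
  · rw [Metric.uniformContinuous_iff]
    intro ε hε
    have hc : Continuous (fun x => c * _root_.ch ξ x) := continuous_const.mul (continuous_ch_right ξ)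
    obtain ⟨δ, hδ, h⟩ := Metric.continuous_iff.1 hc 0 ε hε
    refine ⟨δ, hδ, fun {x y} hxy => ?_⟩
    have h1 := h (y - x) (by simpa [dist_eq_norm, norm_sub_rev] using hxy)
    have h2 := key y (y - x) 0
    have h3 := key 0 (x - y) 0
    simp only [sub_sub_cancel, sub_zero, zero_sub, neg_sub] at h2 h3
    rw [dist_eq_norm] at h1 ⊢
    rw [h2]
    rw [← mul_sub, norm_mul] at h1
    exact h1
  · intro ε hε
    have htb : TotallyBounded (Set.range (fun t : E => c * _root_.ch ξ t)) := by
      apply (isCompact_closedBall (0 : ℂ) ‖c‖).totallyBounded.subset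
      rintro _ ⟨t, rfl⟩
      simp [norm_ch]
    obtain ⟨A, hA, hAf, hAc⟩ := htb.exists_subset (Metric.dist_mem_uniformity hε)
    have hA' : ∀ y ∈ A, ∃ t, c * _root_.ch ξ t = y := fun y hy => hA hy
    choose! q hq using hA'
    classical
    refine ⟨hAf.toFinset.image q, fun t => ?_⟩
    obtain ⟨y, hy, hy'⟩ := Set.mem_iUnion₂.1 (hAc ⟨t, rfl⟩)
    refine ⟨q y, Finset.mem_image_of_mem _ (by simpa using hy), fun x => ?_⟩
    rw [key, ← norm_mul, mul_sub]
    have h1 := hq y hy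
    rw [h1, ← dist_eq_norm]
    exact le_of_lt hy'

/-- Fourier transform of `H τ`. -/
def FT (τ : Measure E) (H : E → ℂ) (x : E) : ℂ := ∫ ξ, ch ξ x * H ξ ∂τ

lemma integrable_ch_mul {τ : Measure E} {H : E → ℂ} (hH : Integrable H τ) (x : E) :
    Integrable (fun ξ => ch ξ x * H ξ) τ :=
  hH.bdd_mul (c := 1) (continuous_ch_left x).aestronglyMeasurable
    (Eventually.of_forall fun ξ => (norm_ch ξ x).le)

lemma TB_FT_finset {τ : Measure E} {H : E → ℂ} (hH : Integrable H τ) (F : Finset E) :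
    TB (FT (τ.restrict F) H) := by
  classical
  induction F using Finset.induction_on with
  | empty =>
    have : FT (τ.restrict ((∅ : Finset E) : Set E)) H = fun _ => 0 := by
      funext x; simp [FT]
    rw [this]; exact TB.zero
  | insert a F ha ih =>
    have : FT (τ.restrict ((insert a F : Finset E) : Set E)) H =
        fun x => (τ.real {a} * H a) * ch a x + FT (τ.restrict F) H x := by
      funext x
      have hi := integrable_ch_mul hH x
      simp only [FT]
      rw [Finset.coe_insert, ← Set.singleton_union, setIntegral_union _ F.measurableSet
        hi.integrableOn hi.integrableOn, integral_singleton]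
      · simp only [Complex.real_smul]; ring
      · simpa using ha
    rw [this]
    exact (TB.ch a _).add ih

lemma TB_FT {τ : Measure E} {H : E → ℂ} (hH : Integrable H τ) {S : Set E} (hS : S.Countable)
    (hτ : τ Sᶜ = 0) : TB (FT τ H) := by
  classical
  rcases S.eq_empty_or_nonempty with rfl | hne
  · have : τ = 0 := by simpa using hτ
    have : FT τ H = fun _ => 0 := by
      funext x; simp [FT, this]
    rw [this]; exact TB.zero
  obtain ⟨u, rfl⟩ := hS.exists_eq_range hne
  let F : ℕ → Finset E := fun n => (Finset.range n).image u
  have hlim := tendsto_setIntegral_of_antitone (μ := τ) (f := fun ξ => ‖H ξ‖)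
    (s := fun n => ((F n : Set E))ᶜ) (fun n => (F n).measurableSet.compl)
    (fun m n hmn => by
      apply Set.compl_subset_compl.2
      exact_mod_cast Finset.image_subset_image (Finset.range_mono hmn))
    ⟨0, hH.norm.integrableOn⟩
  have hI : τ (⋂ n, ((F n : Set E))ᶜ) = 0 := by
    refine measure_mono_null ?_ hτ
    rintro x hx ⟨n, rfl⟩
    have := Set.mem_iInter.1 hx (n + 1)
    apply this
    simp only [F, Finset.coe_image, Finset.coe_range]
    exact ⟨n, by simp, rfl⟩
  rw [setIntegral_measure_zero _ hI] at hlim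
  apply TB.of_approx
  intro ε hε
  obtain ⟨n, hn⟩ := (hlim.eventually (gt_mem_nhds hε)).exists
  refine ⟨_, TB_FT_finset hH (F n), fun x => ?_⟩
  have hi := integrable_ch_mul hH x
  simp only [FT]
  rw [← integral_add_compl (F n).measurableSet hi, add_sub_cancel_left]
  refine (norm_integral_le_integral_norm _).trans (le_of_eq_of_le ?_ hn.le)
  congr 1
  funext ξ
  simp [norm_ch]

lemma ae_diag {τ : Measure E} [SFinite τ] (hτ : ∀ ξ, τ {ξ} = 0) :
    ∀ᵐ p ∂(τ.prod τ), p.1 ≠ p.2 := by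
  rw [Measure.ae_prod_iff_ae_ae]
  · refine Eventually.of_forall fun ξ => ?_
    have := measure_eq_zero_iff_ae_notMem.1 (hτ ξ)
    filter_upwards [this] with η hη h
    exact hη h.symm
  · exact (isClosed_diagonal (X := E)).isOpen_compl.measurableSet

lemma wiener {τ : Measure E} [SFinite τ] (hτ : ∀ ξ, τ {ξ} = 0) {H : E → ℂ}
    (hH : Integrable H τ) (y : E) :
    Tendsto (fun n : ℕ => ∫ t, ‖FT τ H (y - (n : ℝ) • t)‖ ^ 2 ∂(ProbabilityTheory.stdGaussian E))
      atTop (𝓝 0) := by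
  set γ := ProbabilityTheory.stdGaussian E
  set G : E × E → ℂ := fun p => (ch p.1 y * H p.1) * conj (ch p.2 y * H p.2) with hG
  have hGi : Integrable G (τ.prod τ) := by
    have h1 := integrable_ch_mul hH y
    have h2 : Integrable (fun ξ => conj (ch ξ y * H ξ)) τ :=
      (Complex.conjCLE : ℂ →L[ℝ] ℂ).integrable_comp h1
    exact h1.mul_prod h2
  set φ : ℕ → E × E → ℂ := fun n p => cexp (-‖(2 * Real.pi * n) • (p.1 - p.2)‖ ^ 2 / 2) with hφ
  have hφ1 : ∀ n p, ‖φ n p‖ ≤ 1 := by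
    intro n p
    have : φ n p = (Real.exp (-‖(2 * Real.pi * n) • (p.1 - p.2)‖ ^ 2 / 2) : ℂ) := by
      simp [hφ]
    rw [this, Complex.norm_real, Real.norm_eq_abs, Real.abs_exp, Real.exp_le_one_iff]
    have := sq_nonneg ‖(2 * Real.pi * n) • (p.1 - p.2)‖
    linarith
  have key : ∀ n : ℕ, ((∫ t, ‖FT τ H (y - (n : ℝ) • t)‖ ^ 2 ∂γ : ℝ) : ℂ) =
      ∫ p, φ n p * G p ∂(τ.prod τ) := by
    intro n
    rw [← integral_complex_ofReal]
    have h1 : ∀ t : E, ((‖FT τ H (y - (n : ℝ) • t)‖ ^ 2 : ℝ) : ℂ) =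
        ∫ p : E × E, (conj (ch p.1 ((n : ℝ) • t)) * ch p.2 ((n : ℝ) • t)) * G p ∂(τ.prod τ) := by
      intro t
      rw [← Complex.normSq_eq_norm_sq, ← Complex.mul_conj, FT, ← integral_conj,
        ← integral_prod_mul]
      congr 1
      funext p
      simp only [ch_sub, hG, map_mul, Complex.conj_conj]
      ring
    simp_rw [h1]
    rw [integral_integral_swap]
    · congr 1
      funext p
      rw [integral_mul_const]
      congr 1
      have := ProbabilityTheory.charFun_stdGaussian ((2 * Real.pi * n) • (p.1 - p.2))
      rw [charFun_apply] at this
      rw [hφ]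
      refine Eq.trans ?_ (this.trans (by norm_cast))
      congr 1
      funext t
      simp only [ch]
      rw [← Circle.coe_inv_eq_conj, ← Circle.coe_mul, ← AddChar.map_neg_eq_inv,
        ← AddChar.map_add_eq_mul, Real.fourierChar_apply]
      congr 2
      rw [real_inner_smul_right, real_inner_smul_right, real_inner_smul_right, inner_sub_right,
        real_inner_comm t p.1, real_inner_comm t p.2]
      push_cast
      ring
    · refine (hGi.comp_snd γ).bdd_mul (c := 1) ?_ ?_
      · apply Continuous.aestronglyMeasurable
        apply Continuous.mul
        · apply Complex.continuous_conj.comp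
          exact continuous_ch.comp (by fun_prop : Continuous fun q : E × (E × E) =>
            (q.2.1, (n : ℝ) • q.1))
        · exact continuous_ch.comp (by fun_prop : Continuous fun q : E × (E × E) =>
            (q.2.2, (n : ℝ) • q.1))
      · refine Eventually.of_forall fun q => ?_
        simp [norm_ch]
  have lim : Tendsto (fun n : ℕ => ∫ p, φ n p * G p ∂(τ.prod τ)) atTop (𝓝 (∫ p, 0 ∂(τ.prod τ))) := by
    apply tendsto_integral_of_dominated_convergence (fun p => ‖G p‖)
    · intro n
      refine AEStronglyMeasurable.mul ?_ hGi.aestronglyMeasurable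
      apply Continuous.aestronglyMeasurable
      fun_prop
    · exact hGi.norm
    · intro n
      refine Eventually.of_forall fun p => ?_
      rw [norm_mul]
      exact mul_le_of_le_one_left (norm_nonneg _) (hφ1 n p)
    · filter_upwards [ae_diag hτ] with p hp
      rw [← zero_mul (G p)]
      apply Tendsto.mul_const
      have e : ∀ n : ℕ, φ n p = (Real.exp (-((‖(2 * Real.pi) • (p.1 - p.2)‖ ^ 2 / 2) *
          (n : ℝ) ^ 2)) : ℂ) := by
        intro n
        simp only [hφ, Complex.ofReal_exp]
        congr 1
        rw [mul_comm (2 * Real.pi) (n : ℝ), mul_smul, norm_smul]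
        push_cast
        simp
        ring
      simp_rw [e]
      have h0 : 0 < ‖(2 * Real.pi) • (p.1 - p.2)‖ ^ 2 / 2 := by
        have : 0 < ‖(2 * Real.pi) • (p.1 - p.2)‖ := by
          rw [norm_pos_iff]
          exact smul_ne_zero (by positivity) (sub_ne_zero.2 hp)
        positivity
      have : Tendsto (fun n : ℕ => Real.exp (-((‖(2 * Real.pi) • (p.1 - p.2)‖ ^ 2 / 2) *
          (n : ℝ) ^ 2))) atTop (𝓝 0) := by
        apply Real.tendsto_exp_neg_atTop_nhds_zero.comp
        apply Tendsto.const_mul_atTop h0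
        exact (tendsto_pow_atTop two_ne_zero).comp tendsto_natCast_atTop_atTop
      exact_mod_cast (Complex.continuous_ofReal.tendsto 0).comp this
  simp only [integral_zero] at lim
  simp_rw [← key] at lim
  exact_mod_cast (Complex.continuous_re.tendsto 0).comp lim

lemma FT_eq_zero {τ : Measure E} [SFinite τ] (hτ : ∀ ξ, τ {ξ} = 0) {H : E → ℂ}
    (hH : Integrable H τ) (hTB : TB (FT τ H)) (y : E) : FT τ H y = 0 := by
  by_contra hne
  set f := FT τ H
  have hδ : 0 < ‖f y‖ := norm_pos_iff.2 hne
  set δ := ‖f y‖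
  obtain ⟨F, hF⟩ := hTB.2 (δ / 2) (by positivity)
  set γ := ProbabilityTheory.stdGaussian E
  have hb : ∀ x, ‖f x‖ ≤ ∫ ξ, ‖H ξ‖ ∂τ := by
    intro x
    refine (norm_integral_le_integral_norm _).trans (le_of_eq ?_)
    congr 1; funext ξ; simp [norm_ch]
  have hint : ∀ (n : ℕ) (z : E), Integrable (fun t => ‖f (z - (n : ℝ) • t)‖ ^ 2) γ := by
    intro n z
    refine Integrable.of_bound ?_ ((∫ ξ, ‖H ξ‖ ∂τ) ^ 2) ?_
    · apply Continuous.aestronglyMeasurable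
      have := hTB.1.continuous
      fun_prop
    · refine Eventually.of_forall fun t => ?_
      rw [norm_pow, norm_norm]
      exact pow_le_pow_left₀ (norm_nonneg _) (hb _) 2
  have hlow : ∀ n : ℕ, δ ^ 2 / 4 ≤ ∑ s ∈ F, ∫ t, ‖f ((y + s) - (n : ℝ) • t)‖ ^ 2 ∂γ := by
    intro n
    rw [← integral_finsetSum _ (fun s _ => hint n (y + s))]
    have h1 : δ ^ 2 / 4 = ∫ _t : E, δ ^ 2 / 4 ∂γ := by simp
    rw [h1]
    apply integral_mono (integrable_const _) (integrable_finsetSum _ (fun s _ => hint n (y + s)))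
    intro t
    obtain ⟨s, hs, hs'⟩ := hF ((n : ℝ) • t)
    have h2 := hs' (y + s)
    rw [add_sub_cancel_right] at h2
    have h3 : δ / 2 ≤ ‖f (y + s - (n : ℝ) • t)‖ := by
      have h4 : δ ≤ ‖f (y + s - (n : ℝ) • t)‖ + ‖f (y + s - (n : ℝ) • t) - f y‖ := by
        have := norm_sub_le (f (y + s - (n : ℝ) • t)) (f (y + s - (n : ℝ) • t) - f y)
        rwa [sub_sub_cancel] at this
      linarith
    have h5 : δ ^ 2 / 4 ≤ ‖f (y + s - (n : ℝ) • t)‖ ^ 2 := by nlinarith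
    exact h5.trans (Finset.single_le_sum (f := fun s => ‖f (y + s - (n : ℝ) • t)‖ ^ 2)
      (fun i _ => by positivity) hs)
  have hlim : Tendsto (fun n : ℕ => ∑ s ∈ F, ∫ t, ‖f ((y + s) - (n : ℝ) • t)‖ ^ 2 ∂γ) atTop
      (𝓝 (∑ s ∈ F, 0)) := tendsto_finsetSum _ (fun s _ => wiener hτ hH (y + s))
  have := ge_of_tendsto' hlim hlow
  simp only [Finset.sum_const_zero] at this
  have : 0 < δ ^ 2 / 4 := by positivity
  linarith

lemma ae_zero_of_FT {τ : Measure E} [SFinite τ] {H : E → ℂ}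
    (hH : Integrable H τ) (h0 : ∀ y, FT τ H y = 0) : ∀ᵐ ξ ∂τ, H ξ = 0 := by
  apply ae_eq_zero_of_integral_contDiff_smul_eq_zero hH.locallyIntegrable
  intro g hg hgc
  have hg1 : HasCompactSupport (Complex.ofRealCLM ∘ g) := hgc.comp_left rfl
  have hg2 : ContDiff ℝ ((⊤ : ℕ∞) : WithTop ℕ∞) (Complex.ofRealCLM ∘ g) := Complex.ofRealCLM.contDiff.comp hg
  set G : SchwartzMap E ℂ := hg1.toSchwartzMap hg2
  set ψ : SchwartzMap E ℂ := FourierTransformInv.fourierInv G with hψ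
  have hG : ∀ ξ, (g ξ : ℂ) = ∫ v, ch v ξ * ψ v := by
    intro ξ
    have h1 : FourierTransform.fourier ψ = G := FourierTransform.fourier_fourierInv_eq G
    have h2 : (FourierTransform.fourier ψ) ξ = (g ξ : ℂ) := by rw [h1]; rfl
    rw [← h2, SchwartzMap.fourier_coe, Real.fourier_eq]
    rfl
  have e : ∀ ξ, g ξ • H ξ = ∫ v, (ch v ξ * ψ v) * H ξ := by
    intro ξ
    rw [integral_mul_const, ← hG, Complex.real_smul]
  simp_rw [e]
  rw [integral_integral_swap]
  · have : ∀ v, ∫ ξ, ch v ξ * ψ v * H ξ ∂τ = 0 := by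
      intro v
      have h2 := h0 v
      rw [FT] at h2
      have : ∀ ξ, ch v ξ * ψ v * H ξ = ψ v * (ch ξ v * H ξ) := by
        intro ξ
        have : ch v ξ = ch ξ v := by simp only [ch, real_inner_comm]
        rw [this]; ring
      simp_rw [this]
      rw [integral_const_mul, h2, mul_zero]
    simp [this]
  · have h1 := hH.mul_prod (ψ.integrable (μ := volume))
    have h2 := h1.bdd_mul (c := 1) (f := fun p : E × E => ch p.2 p.1)
      (continuous_ch.comp (by fun_prop : Continuous fun q : E × E =>
            (q.2, q.1))).aestronglyMeasurable
      (Eventually.of_forall fun p => (norm_ch _ _).le)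
    refine h2.congr (Eventually.of_forall fun p => ?_)
    simp only [Function.uncurry]
    ring

lemma iteratedFDeriv_const_bound (i : ℕ) (x : E) :
    ‖iteratedFDeriv ℝ i (fun _ : E => (1 : ℂ)) x‖ ≤ 1 := by
  rcases Nat.eq_zero_or_pos i with rfl | h
  · simp
  · rw [iteratedFDeriv_const_of_ne h.ne']; simp

lemma iteratedFDeriv_scale_bound (X : SchwartzMap E ℂ) (i : ℕ) (c : ℝ) (hc0 : 0 ≤ c) (hc1 : c ≤ 1)
    (x : E) :
    ‖iteratedFDeriv ℝ i (fun y : E => X (c • y) - 1) x‖ ≤ SchwartzMap.seminorm ℝ 0 i X + 1 := by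
  have hX : ContDiff ℝ i (X : E → ℂ) := X.smooth i
  have h1 : ContDiff ℝ i (fun y : E => X (c • y)) := hX.comp (contDiff_const_smul c)
  have e : (fun y : E => X (c • y) - 1) = (fun y : E => X (c • y)) - (fun _ => (1 : ℂ)) := rfl
  rw [e, iteratedFDeriv_sub_apply h1.contDiffAt contDiff_const.contDiffAt]
  refine (norm_sub_le _ _).trans (add_le_add ?_ (iteratedFDeriv_const_bound i x))
  let L : E →L[ℝ] E := c • ContinuousLinearMap.id ℝ E
  have e2 : (fun y : E => X (c • y)) = (X : E → ℂ) ∘ L := rfl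
  rw [e2, L.iteratedFDeriv_comp_right hX x le_rfl]
  refine (ContinuousMultilinearMap.norm_compContinuousLinearMap_le _ _).trans ?_
  have hL : ‖L‖ ≤ 1 := by
    refine L.opNorm_le_bound zero_le_one (fun y => ?_)
    simp only [L, _root_.smul_apply, ContinuousLinearMap.id_apply, norm_smul,
      Real.norm_of_nonneg hc0]
    exact mul_le_mul_of_nonneg_right hc1 (norm_nonneg _)
  have hp : (∏ _j : Fin i, ‖L‖) ≤ 1 := Finset.prod_le_one (fun _ _ => norm_nonneg _) (fun _ _ => hL)
  refine (mul_le_of_le_one_right (norm_nonneg _) hp).trans ?_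
  exact SchwartzMap.norm_iteratedFDeriv_le_seminorm ℝ X i (L x)

/-- a cutoff in the Schwartz space -/
lemma exists_cutoff : ∃ X : SchwartzMap E ℂ, HasCompactSupport X ∧ (∀ x, ‖x‖ ≤ 1 → X x = 1) ∧
    ∀ x, ‖X x‖ ≤ 1 := by
  let b : ContDiffBump (0 : E) := ⟨1, 2, one_pos, one_lt_two⟩
  have hg1 : HasCompactSupport (Complex.ofRealCLM ∘ b) := b.hasCompactSupport.comp_left rfl
  have hg2 : ContDiff ℝ ((⊤ : ℕ∞) : WithTop ℕ∞) (Complex.ofRealCLM ∘ b) :=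
    Complex.ofRealCLM.contDiff.comp b.contDiff
  refine ⟨hg1.toSchwartzMap hg2, hg1, fun x hx => ?_, fun x => ?_⟩
  · have : b x = 1 := b.one_of_mem_closedBall (by simpa [b] using hx)
    simp [this]
  · have h1 := b.nonneg (x := x)
    have h2 := b.le_one (x := x)
    simpa [abs_of_nonneg h1] using h2

lemma schwartz_approx (ψ : SchwartzMap E ℂ) : ∃ g : ℕ → SchwartzMap E ℂ,
    (∀ n, IsTestFn (g n)) ∧ Tendsto g atTop (𝓝 ψ) ∧ (∀ n x, ‖g n x‖ ≤ ‖ψ x‖) := by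
  obtain ⟨X, hXc, hX1, hXb⟩ := exists_cutoff (E := E)
  let c : ℕ → ℝ := fun n => ((n : ℝ) + 1)⁻¹
  have hc0 : ∀ n, 0 < c n := fun n => by positivity
  have hc1 : ∀ n, c n ≤ 1 := fun n => inv_le_one_of_one_le₀ (by
    have : (0 : ℝ) ≤ n := Nat.cast_nonneg n
    linarith)
  have hcs : ∀ n, HasCompactSupport (fun x => X (c n • x) * ψ x) := fun n =>
    HasCompactSupport.mul_right (hXc.comp_smul (hc0 n).ne')
  have hsm : ∀ n, ContDiff ℝ ((⊤ : ℕ∞) : WithTop ℕ∞) (fun x => X (c n • x) * ψ x) := fun n =>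
    ((X.smooth ⊤).comp (contDiff_const_smul (c n))).mul (ψ.smooth ⊤)
  refine ⟨fun n => (hcs n).toSchwartzMap (hsm n), fun n => hcs n, ?_, fun n x => ?_⟩
  · rw [(schwartz_withSeminorms ℝ E ℂ).tendsto_nhds]
    rintro ⟨k, l⟩ ε hε
    let M : ℝ := ∑ i ∈ Finset.range (l + 1), (l.choose i : ℝ) * (SchwartzMap.seminorm ℝ 0 i X + 1) *
      SchwartzMap.seminorm ℝ (k + 1) (l - i) ψ
    have hM : 0 ≤ M := Finset.sum_nonneg fun i _ => by positivity
    have hbd : ∀ n, SchwartzMap.seminorm ℝ k l ((hcs n).toSchwartzMap (hsm n) - ψ) ≤ c n * M := by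
      intro n
      apply SchwartzMap.seminorm_le_bound
      · exact mul_nonneg (hc0 n).le hM
      intro x
      have e : ⇑((hcs n).toSchwartzMap (hsm n) - ψ) = fun y => (X (c n • y) - 1) * ψ y := by
        funext y
        simp [sub_mul]
      rw [e]
      rcases lt_or_ge ‖x‖ ((n : ℝ) + 1) with hx | hx
      · have : (fun y => (X (c n • y) - 1) * ψ y) =ᶠ[𝓝 x] fun _ => (0 : ℂ) := by
          have h1 : ∀ᶠ y in 𝓝 x, ‖y‖ < (n : ℝ) + 1 :=
            (continuous_norm.tendsto x).eventually (gt_mem_nhds hx)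
          filter_upwards [h1] with y hy
          rw [hX1, sub_self, zero_mul]
          rw [norm_smul, Real.norm_of_nonneg (hc0 n).le]
          have : c n * ‖y‖ ≤ c n * ((n : ℝ) + 1) := by gcongr
          refine this.trans (le_of_eq ?_)
          exact inv_mul_cancel₀ (by positivity)
        have h2 := (this.iteratedFDeriv ℝ l).eq_of_nhds
        rw [h2]
        have : iteratedFDeriv ℝ l (fun _ : E => (0 : ℂ)) x = 0 := by
          simp
        rw [this]
        simpa using mul_nonneg (hc0 n).le hM
      · have h1 : ContDiff ℝ ((⊤ : ℕ∞) : WithTop ℕ∞) (fun y => X (c n • y) - 1) :=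
          ((X.smooth ⊤).comp (contDiff_const_smul (c n))).sub contDiff_const
        have h2 := norm_iteratedFDeriv_mul_le (N := ((⊤ : ℕ∞) : WithTop ℕ∞)) h1 (ψ.smooth ⊤) x
          (n := l) (by exact_mod_cast le_top)
        have hpos : (0 : ℝ) < (n : ℝ) + 1 := by positivity
        have h3 : ‖x‖ ^ k ≤ c n * ‖x‖ ^ (k + 1) := by
          have : 1 ≤ c n * ‖x‖ := by
            rw [← inv_mul_cancel₀ hpos.ne']
            exact mul_le_mul_of_nonneg_left hx (hc0 n).le
          calc ‖x‖ ^ k = 1 * ‖x‖ ^ k := (one_mul _).symm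
            _ ≤ (c n * ‖x‖) * ‖x‖ ^ k := by gcongr
            _ = _ := by ring
        calc ‖x‖ ^ k * ‖iteratedFDeriv ℝ l (fun y => (X (c n • y) - 1) * ψ y) x‖
            ≤ (c n * ‖x‖ ^ (k + 1)) * ∑ i ∈ Finset.range (l + 1), (l.choose i : ℝ) *
              ‖iteratedFDeriv ℝ i (fun y => X (c n • y) - 1) x‖ *
              ‖iteratedFDeriv ℝ (l - i) ψ x‖ := by
                apply mul_le_mul h3 h2 (norm_nonneg _)
                have := (hc0 n).le
                positivity
          _ = c n * ∑ i ∈ Finset.range (l + 1), (l.choose i : ℝ) *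
              ‖iteratedFDeriv ℝ i (fun y => X (c n • y) - 1) x‖ *
              (‖x‖ ^ (k + 1) * ‖iteratedFDeriv ℝ (l - i) ψ x‖) := by
                rw [mul_assoc, Finset.mul_sum]
                congr 1
                apply Finset.sum_congr rfl
                intro i _
                ring
          _ ≤ c n * M := by
                apply mul_le_mul_of_nonneg_left _ (hc0 n).le
                apply Finset.sum_le_sum
                intro i _
                apply mul_le_mul
                · exact mul_le_mul_of_nonneg_left
                    (iteratedFDeriv_scale_bound X i (c n) (hc0 n).le (hc1 n) x) (by positivity)
                · exact SchwartzMap.le_seminorm ℝ _ _ ψ x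
                · positivity
                · positivity
    have hlim : Tendsto (fun n => c n * M) atTop (𝓝 0) := by
      rw [← zero_mul M]
      apply Tendsto.mul_const
      exact tendsto_inv_atTop_zero.comp
        (tendsto_atTop_add_const_right _ _ tendsto_natCast_atTop_atTop)
    filter_upwards [hlim.eventually (gt_mem_nhds hε)] with n hn
    exact (hbd n).trans_lt hn
  · change ‖X (c n • x) * ψ x‖ ≤ _
    rw [norm_mul]
    exact mul_le_of_le_one_left (norm_nonneg _) (hXb _)

/-- the standard bump -/
def bmpB : ContDiffBump (0 : E) := ⟨1, 2, one_pos, one_lt_two⟩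

/-- its values -/
def bmp (x : E) : ℝ := (bmpB : ContDiffBump (0 : E)) x

/-- the weight -/
def wt (x : E) : ℝ := ((1 + ‖x‖) ^ (Module.finrank ℝ E + 1))⁻¹

lemma wt_pos (x : E) : 0 < wt x := by unfold wt; positivity

lemma continuous_wt : Continuous (wt : E → ℝ) := by
  unfold wt
  refine Continuous.inv₀ (by fun_prop) (fun x => by positivity)

lemma bmp_comp_compact (x : E) : HasCompactSupport (fun y : E => bmp (x - y)) :=
  (bmpB (E := E)).hasCompactSupport.comp_homeomorph (Homeomorph.subLeft x)

lemma bmp_comp_cont (x : E) : Continuous (fun y : E => bmp (x - y)) :=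
  (bmpB (E := E)).continuous.comp (by fun_prop)

/-- clipping to the unit disc -/
def clip (z : ℂ) : ℂ := ((max 1 ‖z‖ : ℝ) : ℂ)⁻¹ * z

lemma continuous_clip : Continuous clip := by
  unfold clip
  refine Continuous.mul (Continuous.inv₀ (by fun_prop) (fun z => ?_)) continuous_id
  have : (0 : ℝ) < max 1 ‖z‖ := lt_max_of_lt_left one_pos
  exact_mod_cast this.ne'

lemma norm_clip_le (z : ℂ) : ‖clip z‖ ≤ 1 := by
  have : (0 : ℝ) < max 1 ‖z‖ := lt_max_of_lt_left one_pos
  rw [clip, norm_mul, norm_inv, Complex.norm_real, Real.norm_of_nonneg this.le,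
    inv_mul_le_iff₀ this, mul_one]
  exact le_max_right _ _

lemma clip_dist (z w : ℂ) (hw : ‖w‖ = 1) : ‖w - clip z‖ ≤ 2 * ‖w - z‖ := by
  have h1 : ‖z - clip z‖ ≤ ‖w - z‖ := by
    rcases le_total ‖z‖ 1 with h | h
    · rw [clip, max_eq_left h]; simp
    · have hp : (0 : ℝ) < ‖z‖ := by linarith
      have e : z - clip z = ((1 - ‖z‖⁻¹ : ℝ) : ℂ) * z := by
        rw [clip, max_eq_right h]; push_cast; ring
      have h2 : 0 ≤ 1 - ‖z‖⁻¹ := by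
        have := inv_le_one_of_one_le₀ h; linarith
      rw [e, norm_mul, Complex.norm_real, Real.norm_of_nonneg h2, sub_mul, one_mul,
        inv_mul_cancel₀ hp.ne', ← hw, norm_sub_rev]
      exact norm_sub_norm_le _ _
  calc ‖w - clip z‖ = ‖(w - z) + (z - clip z)‖ := by congr 1; ring
    _ ≤ _ := norm_add_le _ _
    _ ≤ _ := by linarith

lemma tv_bump_bound (ν : CMeasure E) (h : ν.TransBddM) :
    ∃ C : ℝ, ∀ x, ∫ y, bmp (x - y) ∂ν.tv ≤ C := by
  have := ν.locFin
  have hbi : ∀ x, Integrable (fun y => bmp (x - y)) ν.tv := fun x =>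
    (bmp_comp_cont x).integrable_of_hasCompactSupport (bmp_comp_compact x)
  have hb0 : ∀ z : E, 0 ≤ bmp z := fun z => (bmpB (E := E)).nonneg
  have hb1 : ∀ z : E, bmp z ≤ 1 := fun z => (bmpB (E := E)).le_one
  have hdm : AEStronglyMeasurable ν.density ν.tv := ν.density_meas.aestronglyMeasurable
  have hii : ∀ x (f : E → ℂ) (M : ℝ), Continuous f → (∀ z, ‖f z‖ ≤ M) →
      Integrable (fun y => (bmp (x - y) : ℂ) * f (x - y) * ν.density y) ν.tv := by
    intro x f M hf hM
    have h1 : Integrable (fun y => (bmp (x - y) : ℂ) * f (x - y)) ν.tv :=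
      (hbi x).ofReal.mul_bdd (c := M) (hf.comp (by fun_prop)).aestronglyMeasurable
        (Eventually.of_forall fun y => hM _)
    exact h1.mul_bdd (c := 1) hdm (ν.density_norm.mono fun y hy => hy.le)
  let L : E → (BoundedContinuousFunction E ℂ) →L[ℂ] ℂ := fun x =>
    LinearMap.mkContinuous
      { toFun := fun f => ∫ y, (bmp (x - y) : ℂ) * f (x - y) * ν.density y ∂ν.tv
        map_add' := by
          intro f g
          rw [← integral_add (hii x f ‖f‖ f.continuous f.norm_coe_le_norm)
            (hii x g ‖g‖ g.continuous g.norm_coe_le_norm)]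
          congr 1; funext y
          simp only [BoundedContinuousFunction.coe_add, Pi.add_apply]; ring
        map_smul' := by
          intro c f
          simp only [RingHom.id_apply, smul_eq_mul]
          rw [← integral_const_mul]
          congr 1; funext y
          simp only [BoundedContinuousFunction.coe_smul, smul_eq_mul]; ring }
      (∫ y, bmp (x - y) ∂ν.tv) (by
        intro f
        refine (norm_integral_le_integral_norm _).trans ?_
        rw [← integral_mul_const]
        refine integral_mono_ae (hii x f ‖f‖ f.continuous f.norm_coe_le_norm).norm
          ((hbi x).mul_const _) ?_
        filter_upwards [ν.density_norm] with y hy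
        rw [norm_mul, norm_mul, hy, mul_one, Complex.norm_real, Real.norm_of_nonneg (hb0 _)]
        exact mul_le_mul_of_nonneg_left (f.norm_coe_le_norm _) (hb0 _))
  have hL : ∀ x f, L x f = ∫ y, (bmp (x - y) : ℂ) * f (x - y) * ν.density y ∂ν.tv :=
    fun x f => rfl
  obtain ⟨C, hC⟩ := banach_steinhaus (g := L) (by
    intro f
    obtain ⟨C, hC⟩ := h (fun z => (bmp z : ℂ) * f z)
      ((Complex.continuous_ofReal.comp (bmpB (E := E)).continuous).mul f.continuous)
      (((bmpB (E := E)).hasCompactSupport.comp_left (g := ((↑) : ℝ → ℂ)) rfl).mul_right)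
    exact ⟨C, fun x => hC x⟩)
  refine ⟨C + 2, fun x => ?_⟩
  set B : Set E := closedBall x 2
  have hB : IsCompact B := isCompact_closedBall x 2
  have hfin : IsFiniteMeasure (ν.tv.restrict B) := ⟨by
    rw [Measure.restrict_apply_univ]; exact hB.measure_lt_top⟩
  have hci : Integrable (fun y => conj (ν.density y)) (ν.tv.restrict B) := by
    refine Integrable.of_bound ?_ 1 ?_
    · exact (Complex.continuous_conj.measurable.comp ν.density_meas).aestronglyMeasurable
    · filter_upwards [ae_restrict_of_ae ν.density_norm] with y hy
      rw [RCLike.norm_conj, hy]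
  obtain ⟨g, -, hg, hgc, hgi⟩ := hci.exists_hasCompactSupport_integral_sub_le one_pos
  let f : BoundedContinuousFunction E ℂ := BoundedContinuousFunction.ofNormedAddCommGroup
    (fun z => clip (g (x - z))) (continuous_clip.comp (hgc.comp (by fun_prop))) 1
    (fun z => norm_clip_le _)
  have hf1 : ‖f‖ ≤ 1 := BoundedContinuousFunction.norm_ofNormedAddCommGroup_le _ zero_le_one _
  have hff : ∀ y, f (x - y) = clip (g y) := by
    intro y
    change clip (g (x - (x - y))) = _
    rw [sub_sub_cancel]
  have h1 : ‖L x f‖ ≤ C := by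
    refine ((L x).le_opNorm f).trans ?_
    exact (mul_le_of_le_one_right (norm_nonneg _) hf1).trans (hC x)
  have hI1 := hii x f ‖f‖ f.continuous f.norm_coe_le_norm
  have h2 : ((∫ y, bmp (x - y) ∂ν.tv : ℝ) : ℂ) - L x f =
      ∫ y, ((bmp (x - y) : ℂ) - (bmp (x - y) : ℂ) * f (x - y) * ν.density y) ∂ν.tv := by
    rw [hL, ← integral_complex_ofReal]
    exact (integral_sub (hbi x).ofReal hI1).symm
  have h3 : ‖((∫ y, bmp (x - y) ∂ν.tv : ℝ) : ℂ) - L x f‖ ≤ 2 := by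
    rw [h2]
    have hz : ∀ y ∉ B, (bmp (x - y) : ℂ) - (bmp (x - y) : ℂ) * f (x - y) * ν.density y = 0 := by
      intro y hy
      have : bmp (x - y) = 0 := by
        apply (bmpB (E := E)).zero_of_le_dist
        simp only [B, mem_closedBall, not_le] at hy
        rw [dist_eq_norm, norm_sub_rev] at hy
        simpa [bmpB] using hy.le
      rw [this]; simp
    rw [← setIntegral_eq_integral_of_forall_compl_eq_zero hz]
    refine (norm_integral_le_integral_norm _).trans ?_
    have hI2 : Integrable (fun y => 2 * ‖conj (ν.density y) - g y‖) (ν.tv.restrict B) :=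
      (hci.sub hgi).norm.const_mul 2
    calc _ ≤ ∫ y in B, 2 * ‖conj (ν.density y) - g y‖ ∂ν.tv := by
          refine integral_mono_ae ((hbi x).ofReal.sub hI1).norm.integrableOn hI2 ?_
          filter_upwards [ae_restrict_of_ae ν.density_norm] with y hy
          have e : (bmp (x - y) : ℂ) - (bmp (x - y) : ℂ) * f (x - y) * ν.density y =
              (bmp (x - y) : ℂ) * ((conj (ν.density y) - clip (g y)) * ν.density y) := by
            have : conj (ν.density y) * ν.density y = 1 := by
              rw [mul_comm, Complex.mul_conj, Complex.normSq_eq_norm_sq, hy]; norm_num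
            rw [hff, sub_mul, this]; ring
          have hy' : ‖conj (ν.density y)‖ = 1 := by rw [RCLike.norm_conj, hy]
          rw [e, norm_mul, norm_mul, hy, mul_one, Complex.norm_real,
            Real.norm_of_nonneg (hb0 _)]
          exact (mul_le_of_le_one_left (norm_nonneg _) (hb1 _)).trans (clip_dist _ _ hy')
      _ ≤ 2 := by
          rw [integral_const_mul]; linarith
  have h4 := norm_add_le (L x f) (((∫ y, bmp (x - y) ∂ν.tv : ℝ) : ℂ) - L x f)
  rw [add_sub_cancel, Complex.norm_real] at h4
  have h5 := Real.le_norm_self (∫ y, bmp (x - y) ∂ν.tv)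
  linarith

lemma wt_shift (x y u : E) (h : ‖u - y‖ ≤ 2) :
    wt (x - y) ≤ 3 ^ (Module.finrank ℝ E + 1) * wt (x - u) := by
  unfold wt
  have h1 : 1 + ‖x - u‖ ≤ 3 * (1 + ‖x - y‖) := by
    have : ‖x - u‖ ≤ ‖x - y‖ + ‖u - y‖ := by
      have := norm_sub_le (x - y) (u - y)
      simpa using this
    have := norm_nonneg (x - y)
    linarith
  rw [← div_eq_mul_inv, le_div_iff₀ (by positivity), inv_mul_le_iff₀ (by positivity), mul_comm,
    ← mul_pow]
  exact pow_le_pow_left₀ (by positivity) h1 _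

lemma lintegral_wt_lt_top : ∫⁻ u : E, ENNReal.ofReal (wt u) < ∞ := by
  have h := integrable_one_add_norm (E := E) (μ := volume) (r := (Module.finrank ℝ E + 1 : ℕ))
    (by push_cast; linarith)
  have e : (fun x : E => (1 + ‖x‖) ^ (-((Module.finrank ℝ E + 1 : ℕ) : ℝ))) = wt := by
    funext x
    rw [Real.rpow_neg (by positivity), Real.rpow_natCast]; rfl
  rw [e] at h
  exact (hasFiniteIntegral_iff_ofReal (Eventually.of_forall fun x => (wt_pos x).le)).1 h.2

lemma tv_wt_bound (ν : CMeasure E) (h : ν.TransBddM) :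
    ∃ K : ℝ, 0 ≤ K ∧ ∀ x, ∫⁻ y, ENNReal.ofReal (wt (x - y)) ∂ν.tv ≤ ENNReal.ofReal K := by
  have := ν.locFin
  obtain ⟨C, hC⟩ := tv_bump_bound ν h
  have hb0 : ∀ z : E, 0 ≤ bmp z := fun z => (bmpB (E := E)).nonneg
  have hbi : ∀ x, Integrable (fun y => bmp (x - y)) ν.tv := fun x =>
    (bmp_comp_cont x).integrable_of_hasCompactSupport (bmp_comp_compact x)
  have hC' : ∀ x, ∫⁻ y, ENNReal.ofReal (bmp (x - y)) ∂ν.tv ≤ ENNReal.ofReal C := by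
    intro x
    rw [← ofReal_integral_eq_lintegral_ofReal (hbi x) (Eventually.of_forall fun y => hb0 _)]
    exact ENNReal.ofReal_le_ofReal (hC x)
  set c : ℝ≥0∞ := ∫⁻ u : E, ENNReal.ofReal (bmp u) with hc
  have hbiv : Integrable (fun u : E => bmp u) volume := (bmpB (E := E)).integrable
  have hc1 : c = ENNReal.ofReal (∫ u : E, bmp u) :=
    (ofReal_integral_eq_lintegral_ofReal hbiv (Eventually.of_forall fun y => hb0 _)).symm
  have hc0 : c ≠ 0 := by
    rw [hc1]
    exact (ENNReal.ofReal_pos.2 (bmpB (E := E)).integral_pos).ne'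
  have hct : c ≠ ∞ := by rw [hc1]; exact ENNReal.ofReal_ne_top
  set D : ℝ≥0∞ := ENNReal.ofReal (3 ^ (Module.finrank ℝ E + 1)) * ENNReal.ofReal C *
    (∫⁻ u : E, ENNReal.ofReal (wt u)) with hD
  have hDt : D ≠ ∞ := ENNReal.mul_ne_top (ENNReal.mul_ne_top ENNReal.ofReal_ne_top
    ENNReal.ofReal_ne_top) lintegral_wt_lt_top.ne
  have hmb : Measurable (fun u : E => ENNReal.ofReal (bmp u)) :=
    ENNReal.measurable_ofReal.comp (bmpB (E := E)).continuous.measurable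
  have hmw : Measurable (fun u : E => ENNReal.ofReal (wt u)) :=
    ENNReal.measurable_ofReal.comp continuous_wt.measurable
  have hmbl : ∀ u : E, Measurable (fun y : E => ENNReal.ofReal (bmp (u - y))) := fun u =>
    hmb.comp (measurable_const.sub measurable_id)
  have hmwl : ∀ u : E, Measurable (fun y : E => ENNReal.ofReal (wt (u - y))) := fun u =>
    hmw.comp (measurable_const.sub measurable_id)
  have hmbr : ∀ y : E, Measurable (fun u : E => ENNReal.ofReal (bmp (u - y))) := fun u =>
    hmb.comp (measurable_id.sub measurable_const)
  have main : ∀ x, (∫⁻ y, ENNReal.ofReal (wt (x - y)) ∂ν.tv) * c ≤ D := by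
    intro x
    calc (∫⁻ y, ENNReal.ofReal (wt (x - y)) ∂ν.tv) * c
        = ∫⁻ y, ENNReal.ofReal (wt (x - y)) * c ∂ν.tv :=
          (lintegral_mul_const _ (hmwl _)).symm
      _ = ∫⁻ y, (∫⁻ u, ENNReal.ofReal (wt (x - y)) * ENNReal.ofReal (bmp (u - y))) ∂ν.tv := by
          congr 1; funext y
          rw [lintegral_const_mul _ (hmbr _),
            lintegral_sub_right_eq_self (fun u => ENNReal.ofReal (bmp u)) y]
      _ ≤ ∫⁻ y, (∫⁻ u, ENNReal.ofReal (3 ^ (Module.finrank ℝ E + 1)) *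
            (ENNReal.ofReal (wt (x - u)) * ENNReal.ofReal (bmp (u - y)))) ∂ν.tv := by
          apply lintegral_mono; intro y
          apply lintegral_mono; intro u
          dsimp only
          rcases le_or_gt ‖u - y‖ 2 with hu | hu
          · rw [← mul_assoc]
            refine mul_le_mul_left ?_ _
            rw [← ENNReal.ofReal_mul (by positivity)]
            exact ENNReal.ofReal_le_ofReal (wt_shift x y u hu)
          · have : bmp (u - y) = 0 := by
              apply (bmpB (E := E)).zero_of_le_dist
              simpa [bmpB] using hu.le
            rw [this]; simp
      _ = ∫⁻ u, ∫⁻ y, ENNReal.ofReal (3 ^ (Module.finrank ℝ E + 1)) *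
            (ENNReal.ofReal (wt (x - u)) * ENNReal.ofReal (bmp (u - y))) ∂ν.tv := by
          apply lintegral_lintegral_swap
          apply Measurable.aemeasurable
          change Measurable (fun p : E × E => ENNReal.ofReal (3 ^ (Module.finrank ℝ E + 1)) *
            (ENNReal.ofReal (wt (x - p.2)) * ENNReal.ofReal (bmp (p.2 - p.1))))
          refine Measurable.const_mul (Measurable.fun_mul ?_ ?_) _
          · exact hmw.comp (measurable_const.sub measurable_snd)
          · exact hmb.comp (measurable_snd.sub measurable_fst)
      _ ≤ ∫⁻ u, ENNReal.ofReal (3 ^ (Module.finrank ℝ E + 1)) *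
            (ENNReal.ofReal (wt (x - u)) * ENNReal.ofReal C) := by
          apply lintegral_mono; intro u
          dsimp only
          rw [lintegral_const_mul _ (by
              exact (hmbl u).const_mul _),
            lintegral_const_mul _ (hmbl _)]
          gcongr
          exact hC' u
      _ = D := by
          rw [lintegral_const_mul _ (by
              exact (hmwl x).mul_const _),
            lintegral_mul_const _ (hmwl _),
            lintegral_sub_left_eq_self (fun u => ENNReal.ofReal (wt u)) x, hD]
          ring
  refine ⟨(D / c).toReal, ENNReal.toReal_nonneg, fun x => ?_⟩
  rw [ENNReal.ofReal_toReal (ENNReal.div_ne_top hDt hc0)]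
  rw [ENNReal.le_div_iff_mul_le (Or.inl hc0) (Or.inl hct)]
  exact main x

lemma tv_pair_bound (ν : CMeasure E) (h : ν.TransBddM) :
    ∃ K : ℝ, 0 ≤ K ∧ ∀ (x : E) (B : ℝ) (φ : E → ℂ), 0 ≤ B → Continuous φ →
      (∀ y, ‖φ y‖ ≤ B * wt (x - y)) →
      Integrable (fun y => φ y * ν.density y) ν.tv ∧
        ‖∫ y, φ y * ν.density y ∂ν.tv‖ ≤ B * K := by
  obtain ⟨K, hK0, hK⟩ := tv_wt_bound ν h
  refine ⟨K, hK0, fun x B φ hB hφ hb => ?_⟩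
  have hw0 : ∀ᵐ y ∂ν.tv, 0 ≤ wt (x - y) := Eventually.of_forall fun y => (wt_pos _).le
  have hwc : Continuous (fun y => wt (x - y)) := continuous_wt.comp (by fun_prop)
  have hwi : Integrable (fun y => wt (x - y)) ν.tv :=
    ⟨hwc.aestronglyMeasurable, (hasFiniteIntegral_iff_ofReal hw0).2
      ((hK x).trans_lt ENNReal.ofReal_lt_top)⟩
  have hwK : ∫ y, wt (x - y) ∂ν.tv ≤ K := by
    rw [integral_eq_lintegral_of_nonneg_ae hw0 hwc.aestronglyMeasurable]
    exact ENNReal.toReal_le_of_le_ofReal hK0 (hK x)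
  have hbd : ∀ᵐ y ∂ν.tv, ‖φ y * ν.density y‖ ≤ B * wt (x - y) := by
    filter_upwards [ν.density_norm] with y hy
    rw [norm_mul, hy, mul_one]; exact hb y
  have hi : Integrable (fun y => φ y * ν.density y) ν.tv :=
    (hwi.const_mul B).mono' (hφ.aestronglyMeasurable.mul ν.density_meas.aestronglyMeasurable) hbd
  refine ⟨hi, (norm_integral_le_of_norm_le (hwi.const_mul B) hbd).trans ?_⟩
  rw [integral_const_mul]
  exact mul_le_mul_of_nonneg_left hwK hB

open FourierTransform in
lemma schwartz_wt (ψ : SchwartzMap E ℂ) (x : E) :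
    ‖ψ x‖ ≤ 2 ^ (Module.finrank ℝ E + 1) * (SchwartzMap.seminorm ℝ 0 0 ψ +
      SchwartzMap.seminorm ℝ (Module.finrank ℝ E + 1) 0 ψ) * wt x := by
  unfold wt
  rw [← div_eq_mul_inv, le_div_iff₀ (by positivity)]
  have h0 := SchwartzMap.norm_le_seminorm ℝ ψ x
  have h1 := SchwartzMap.norm_pow_mul_le_seminorm ℝ ψ (Module.finrank ℝ E + 1) x
  have h2 : (1 + ‖x‖) ^ (Module.finrank ℝ E + 1) ≤
      2 ^ (Module.finrank ℝ E + 1) * (1 + ‖x‖ ^ (Module.finrank ℝ E + 1)) := by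
    have := add_pow_le zero_le_one (norm_nonneg x) (Module.finrank ℝ E + 1)
    rw [one_pow, Nat.add_sub_cancel] at this
    refine this.trans ?_
    gcongr
    · norm_num
    · omega
  calc ‖ψ x‖ * (1 + ‖x‖) ^ (Module.finrank ℝ E + 1)
      ≤ ‖ψ x‖ * (2 ^ (Module.finrank ℝ E + 1) * (1 + ‖x‖ ^ (Module.finrank ℝ E + 1))) := by gcongr
    _ = 2 ^ (Module.finrank ℝ E + 1) * (‖ψ x‖ + ‖x‖ ^ (Module.finrank ℝ E + 1) * ‖ψ x‖) := by ring
    _ ≤ _ := by gcongr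

/-- continuous with weighted bound -/
def WB (φ : E → ℂ) : Prop := Continuous φ ∧ ∃ C : ℝ, 0 ≤ C ∧ ∀ z, ‖φ z‖ ≤ C * wt z

lemma WB.schwartz (ψ : SchwartzMap E ℂ) : WB (ψ : E → ℂ) :=
  ⟨ψ.continuous, _, by positivity, schwartz_wt ψ⟩

lemma WB.cc {φ : E → ℂ} (h : Continuous φ) (hc : HasCompactSupport φ) : WB φ := by
  obtain ⟨C, hC⟩ := (hc.smul_left (f := fun z => (wt z)⁻¹)).exists_bound_of_continuous
    ((continuous_wt.inv₀ fun z => (wt_pos z).ne').smul h)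
  refine ⟨h, C, (norm_nonneg _).trans (hC 0), fun z => ?_⟩
  have := hC z
  have hp := wt_pos z
  rw [Pi.smul_apply', norm_smul, norm_inv, Real.norm_of_nonneg hp.le, inv_mul_le_iff₀ hp] at this
  linarith

lemma tendsto_wt {g : ℕ → SchwartzMap E ℂ} {ψ : SchwartzMap E ℂ} (h : Tendsto g atTop (𝓝 ψ))
    {ε : ℝ} (hε : 0 < ε) : ∀ᶠ n in atTop, ∀ x, ‖ψ x - g n x‖ ≤ ε * wt x := by
  rw [(schwartz_withSeminorms ℝ E ℂ).tendsto_nhds] at h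
  set D : ℝ := 2 ^ (Module.finrank ℝ E + 1) with hD
  have hDp : 0 < D := by positivity
  have a := h (0, 0) (ε / (2 * D)) (by positivity)
  have b := h (Module.finrank ℝ E + 1, 0) (ε / (2 * D)) (by positivity)
  filter_upwards [a, b] with n ha hb x
  have := schwartz_wt (g n - ψ) x
  rw [sub_apply, norm_sub_rev] at this
  refine this.trans ?_
  have hp := wt_pos x
  change SchwartzMap.seminorm ℝ 0 0 (g n - ψ) < _ at ha
  change SchwartzMap.seminorm ℝ (Module.finrank ℝ E + 1) 0 (g n - ψ) < _ at hb
  have : D * (ε / (2 * D) + ε / (2 * D)) = ε := by field_simp; ring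
  calc _ ≤ D * (ε / (2 * D) + ε / (2 * D)) * wt x := by gcongr
    _ = _ := by rw [this]

lemma conv_close (ν : CMeasure E) (h : ν.TransBddM) :
    ∃ K : ℝ, 0 ≤ K ∧ ∀ (B : ℝ) (φ ψ : E → ℂ), 0 ≤ B → WB φ → WB ψ →
      (∀ z, ‖φ z - ψ z‖ ≤ B * wt z) → ∀ x, ‖ν.convM φ x - ν.convM ψ x‖ ≤ B * K := by
  obtain ⟨K, hK0, hK⟩ := tv_pair_bound ν h
  refine ⟨K, hK0, ?_⟩
  rintro B φ ψ hB ⟨hφ, C, hC0, hC⟩ ⟨hψ, C', hC0', hC'⟩ hd x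
  have h1 := (hK x C (fun y => φ (x - y)) hC0 (hφ.comp (by fun_prop)) (fun y => hC _)).1
  have h2 := (hK x C' (fun y => ψ (x - y)) hC0' (hψ.comp (by fun_prop)) (fun y => hC' _)).1
  have h3 := (hK x B (fun y => φ (x - y) - ψ (x - y)) hB
    ((hφ.comp (by fun_prop)).sub (hψ.comp (by fun_prop))) (fun y => hd _)).2
  simp only [CMeasure.convM]
  rw [← integral_sub h1 h2]
  simpa only [sub_mul] using h3

lemma conv_TB_of_approx (ν : CMeasure E) (h : ν.TransBddM) {φ : E → ℂ} (hφ : WB φ)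
    (ha : ∀ ε : ℝ, 0 < ε → ∃ g, WB g ∧ TB (ν.convM g) ∧ ∀ z, ‖φ z - g z‖ ≤ ε * wt z) :
    TB (ν.convM φ) := by
  obtain ⟨K, hK0, hK⟩ := conv_close ν h
  apply TB.of_approx
  intro ε hε
  obtain ⟨g, hg, hT, hd⟩ := ha (ε / (K + 1)) (by positivity)
  refine ⟨_, hT, fun x => (hK _ φ g (by positivity) hφ hg hd x).trans ?_⟩
  rw [div_mul_eq_mul_div, div_le_iff₀ (by positivity)]
  nlinarith

lemma agrees_schwartz (ν : CMeasure E) (h : ν.TransBddM) (T' : SchwartzMap E ℂ →L[ℂ] ℂ)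
    (hT : ν.Agrees T') (ψ : SchwartzMap E ℂ) : T' ψ = ν.pairing ψ := by
  obtain ⟨K, hK0, hK⟩ := tv_pair_bound ν h
  obtain ⟨g, hg, hlim, -⟩ := schwartz_approx ψ
  have h1 : Tendsto (fun n => T' (g n)) atTop (𝓝 (T' ψ)) := (T'.continuous.tendsto ψ).comp hlim
  refine tendsto_nhds_unique h1 ?_
  have hw : ∀ y : E, wt (0 - y) = wt y := fun y => by simp [wt]
  have hi : ∀ f : SchwartzMap E ℂ, Integrable (fun y => f y * ν.density y) ν.tv := by
    intro f
    obtain ⟨hc, C, hC0, hC⟩ := WB.schwartz f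
    exact (hK 0 C f hC0 hc (fun y => by rw [hw]; exact hC y)).1
  rw [Metric.tendsto_nhds]
  intro ε hε
  filter_upwards [tendsto_wt hlim (ε := ε / (K + 1)) (by positivity)] with n hn
  rw [hT _ (hg n), dist_comm, dist_eq_norm, CMeasure.pairing, CMeasure.pairing,
    ← integral_sub (hi _) (hi _)]
  have := (hK 0 (ε / (K + 1)) (fun y => ψ y - g n y) (by positivity)
    (ψ.continuous.sub (g n).continuous) (fun y => by rw [hw]; exact hn y)).2
  simp only [sub_mul] at this
  refine this.trans_lt ?_
  rw [div_mul_eq_mul_div, div_lt_iff₀ (by positivity)]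
  nlinarith

lemma contDiff_ch (x : E) : ContDiff ℝ ((⊤ : ℕ∞) : WithTop ℕ∞) (fun ξ : E => ch ξ x) := by
  unfold ch
  simp only [Real.fourierChar_apply]
  refine ContDiff.cexp ?_
  refine ContDiff.mul (Complex.ofRealCLM.contDiff.comp ?_) contDiff_const
  exact contDiff_const.mul (contDiff_id.inner ℝ contDiff_const).neg

open FourierTransform in
lemma conv_fourier (ν : CMeasure E) (h : ν.TransBddM) (μ : CMeasure E)
    (T : SchwartzMap E ℂ →L[ℂ] ℂ) (hμ : μ.Agrees T) (hT : ν.Agrees (fourierTD T))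
    (g : SchwartzMap E ℂ) (hg : IsTestFn g) :
    ν.convM (𝓕 g : SchwartzMap E ℂ) = FT μ.tv (fun ξ => g ξ * μ.density ξ) := by
  funext x
  have hcs : HasCompactSupport (fun ξ => ch ξ x * g ξ) := HasCompactSupport.mul_left hg
  let G : SchwartzMap E ℂ := hcs.toSchwartzMap ((contDiff_ch x).mul (g.smooth ⊤))
  have e1 : transRefl x (𝓕 g) = 𝓕⁻ G := by
    ext y
    rw [transRefl_apply, SchwartzMap.fourierInv_coe, SchwartzMap.fourier_coe,
      Real.fourier_eq, Real.fourierInv_eq]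
    congr 1; funext ξ
    change _ = Real.fourierChar (inner ℝ ξ y) • (ch ξ x * g ξ)
    rw [Circle.smul_def, Circle.smul_def, smul_eq_mul, smul_eq_mul, ← mul_assoc]
    congr 1
    rw [ch, ← Circle.coe_mul, ← AddChar.map_add_eq_mul, inner_sub_right]
    congr 2
    ring
  have e2 : fourierTD T (transRefl x (𝓕 g)) = T G := by
    change T (𝓕 (transRefl x (𝓕 g))) = _
    rw [e1, FourierTransform.fourier_fourierInv_eq]
  have e3 := agrees_schwartz ν h _ hT (transRefl x (𝓕 g))
  rw [e2, hμ G hcs] at e3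
  change _ = ν.convM (𝓕 g : SchwartzMap E ℂ) x at e3
  rw [← e3, FT, CMeasure.pairing]
  congr 1; funext ξ
  change ch ξ x * g ξ * _ = _
  ring

lemma integrable_test (μ : CMeasure E) (g : SchwartzMap E ℂ) (hg : IsTestFn g) :
    Integrable (fun ξ => g ξ * μ.density ξ) μ.tv := by
  have := μ.locFin
  exact (g.continuous.integrable_of_hasCompactSupport hg).mul_bdd (c := 1)
    μ.density_meas.aestronglyMeasurable (μ.density_norm.mono fun y hy => hy.le)

open FourierTransform in
lemma sap_of_pp (ν : CMeasure E) (h : ν.TransBddM) (μ : CMeasure E)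
    (T : SchwartzMap E ℂ →L[ℂ] ℂ) (hμ : μ.Agrees T) (hT : ν.Agrees (fourierTD T))
    (hpp : μ.IsPurePoint) : ν.SAPM := by
  obtain ⟨S, hS, hS0⟩ := hpp
  have step : ∀ ψ : SchwartzMap E ℂ, TB (ν.convM ψ) := by
    intro ψ
    obtain ⟨g, hg, hlim, -⟩ := schwartz_approx (𝓕⁻ ψ)
    have hlim2 : Tendsto (fun n => 𝓕 (g n)) atTop (𝓝 ψ) := by
      have := ((SchwartzMap.fourierTransformCLM ℂ (V := E) (E := ℂ)).continuous.tendsto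
        (𝓕⁻ ψ)).comp hlim
      rw [SchwartzMap.fourierTransformCLM_apply, FourierTransform.fourier_fourierInv_eq] at this
      exact this
    refine conv_TB_of_approx ν h (WB.schwartz ψ) fun ε hε => ?_
    obtain ⟨n, hn⟩ := (tendsto_wt hlim2 hε).exists
    refine ⟨(𝓕 (g n) : SchwartzMap E ℂ), WB.schwartz _, ?_, hn⟩
    rw [conv_fourier ν h μ T hμ hT (g n) (hg n)]
    exact TB_FT (integrable_test μ _ (hg n)) hS hS0
  intro φ hφ hc
  refine TB.bohr ?_ (h φ hφ hc)
  refine conv_TB_of_approx ν h (WB.cc hφ hc) fun ε hε => ?_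
  obtain ⟨g, hg, hgd, hgs⟩ := hφ.exists_contDiff_approx ⊤ (continuous_wt.const_mul ε)
    (fun x => mul_pos hε (wt_pos x))
  have hgc : HasCompactSupport g := hc.mono hgs
  refine ⟨g, WB.cc hg.continuous hgc, step (hgc.toSchwartzMap hg), fun z => ?_⟩
  have := hgd z
  rw [dist_comm, dist_eq_norm] at this
  exact this.le

open FourierTransform in
lemma pp_of_sap (ν : CMeasure E) (hs : ν.SAPM) (h : ν.TransBddM) (μ : CMeasure E)
    (T : SchwartzMap E ℂ →L[ℂ] ℂ) (hμ : μ.Agrees T) (hT : ν.Agrees (fourierTD T)) :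
    μ.IsPurePoint := by
  have := μ.locFin
  have step : ∀ ψ : SchwartzMap E ℂ, TB (ν.convM ψ) := by
    intro ψ
    obtain ⟨g, hg, hlim, -⟩ := schwartz_approx ψ
    refine conv_TB_of_approx ν h (WB.schwartz ψ) fun ε hε => ?_
    obtain ⟨n, hn⟩ := (tendsto_wt hlim hε).exists
    exact ⟨g n, WB.schwartz _, TB.of_bohr (hs _ (g n).continuous (hg n)), hn⟩
  set S : Set E := {ξ | 0 < μ.tv {ξ}} with hSdef
  have hS : S.Countable :=
    Measure.countable_meas_pos_of_disjoint_iUnion (fun ξ => measurableSet_singleton ξ)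
      (fun a b hab => by simpa using hab)
  have hSm : MeasurableSet S := hS.measurableSet
  refine ⟨S, hS, ?_⟩
  have key : ∀ g : SchwartzMap E ℂ, IsTestFn g →
      ∀ᵐ ξ ∂(μ.tv.restrict Sᶜ), g ξ * μ.density ξ = 0 := by
    intro g hg
    have hi := integrable_test μ g hg
    have h1 : TB (FT μ.tv (fun ξ => g ξ * μ.density ξ)) := by
      rw [← conv_fourier ν h μ T hμ hT g hg]; exact step _
    have h2 : TB (FT (μ.tv.restrict S) (fun ξ => -(g ξ * μ.density ξ))) :=
      TB_FT hi.neg.restrict hS (by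
        rw [Measure.restrict_apply hSm.compl, Set.compl_inter_self, measure_empty])
    have h3 : FT (μ.tv.restrict Sᶜ) (fun ξ => g ξ * μ.density ξ) =
        fun x => FT μ.tv (fun ξ => g ξ * μ.density ξ) x +
          FT (μ.tv.restrict S) (fun ξ => -(g ξ * μ.density ξ)) x := by
      funext x
      simp only [FT, mul_neg]
      rw [integral_neg, ← integral_add_compl hSm (integrable_ch_mul hi x)]
      ring
    have h4 : TB (FT (μ.tv.restrict Sᶜ) (fun ξ => g ξ * μ.density ξ)) := by
      rw [h3]; exact h1.add h2
    refine ae_zero_of_FT hi.restrict (FT_eq_zero ?_ hi.restrict h4)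
    intro ξ
    rw [Measure.restrict_apply (measurableSet_singleton ξ)]
    by_cases hξ : ξ ∈ S
    · have : ({ξ} ∩ Sᶜ : Set E) = ∅ := by
        ext z; simp only [Set.mem_inter_iff, Set.mem_singleton_iff, Set.mem_compl_iff,
          Set.mem_empty_iff_false, iff_false, not_and, not_not]
        rintro rfl; exact hξ
      rw [this, measure_empty]
    · have h0 : μ.tv {ξ} = 0 := by
        simpa [hSdef] using hξ
      exact measure_mono_null Set.inter_subset_left h0
  have key2 : ∀ n : ℕ, ∀ᵐ ξ ∂(μ.tv.restrict Sᶜ), (n : ℝ) + 1 < ‖ξ‖ := by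
    intro n
    obtain ⟨X, hXc, hX1, -⟩ := exists_cutoff (E := E)
    have hc : (0 : ℝ) < ((n : ℝ) + 1)⁻¹ := by positivity
    have hcs : HasCompactSupport (fun x => X (((n : ℝ) + 1)⁻¹ • x)) := hXc.comp_smul hc.ne'
    have hsm : ContDiff ℝ ((⊤ : ℕ∞) : WithTop ℕ∞) (fun x => X (((n : ℝ) + 1)⁻¹ • x)) :=
      (X.smooth ⊤).comp (contDiff_const_smul _)
    filter_upwards [key (hcs.toSchwartzMap hsm) hcs, ae_restrict_of_ae μ.density_norm] with ξ h1 h2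
    by_contra! h3
    have h4 : X (((n : ℝ) + 1)⁻¹ • ξ) = 1 := by
      apply hX1
      rw [norm_smul, Real.norm_of_nonneg hc.le, inv_mul_le_iff₀ (by positivity), mul_one]
      exact h3
    change X (((n : ℝ) + 1)⁻¹ • ξ) * μ.density ξ = 0 at h1
    rw [h4, one_mul] at h1
    rw [h1, norm_zero] at h2
    exact zero_ne_one h2
  have key3 : ∀ᵐ ξ ∂(μ.tv.restrict Sᶜ), False := by
    filter_upwards [ae_all_iff.2 key2] with ξ hξ
    obtain ⟨n, hn⟩ := exists_nat_gt ‖ξ‖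
    linarith [hξ n]
  rw [ae_iff] at key3
  simpa using key3

end Work


/-- For a tempered measure `μ` on `ℝ^d`, the Fourier transform `μ̂` is a
strongly almost periodic measure iff `μ̂` is a translation-bounded measure and `μ` is pure
point; here both sides include the assertion that `μ̂` agrees with a measure. -/
theorem fourier_sapM_iff (d : ℕ)
    (μ : CMeasure (EuclideanSpace ℝ (Fin d)))
    (T : SchwartzMap (EuclideanSpace ℝ (Fin d)) ℂ →L[ℂ] ℂ)
    (hμT : μ.Agrees T) :
    (∃ ν : CMeasure (EuclideanSpace ℝ (Fin d)), ν.Agrees (fourierTD T) ∧ ν.SAPM) ↔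
      ((∃ ν : CMeasure (EuclideanSpace ℝ (Fin d)), ν.Agrees (fourierTD T) ∧ ν.TransBddM) ∧
        μ.IsPurePoint) := by
  constructor
  · rintro ⟨ν, hν, hs⟩
    have hb : ν.TransBddM := fun φ hφ hc => (hs φ hφ hc).2.1
    exact ⟨⟨ν, hν, hb⟩, pp_of_sap ν hs hb μ T hμT hν⟩
  · rintro ⟨⟨ν, hν, hb⟩, hpp⟩
    exact ⟨ν, hν, sap_of_pp ν hb μ T hμT hν hpp⟩
end
end

section
/- Let T ∈ 𝒮′(ℝ^d) be a tempered distribution. Then T is strongly almost periodic as a tempered distribution if and only if T is translation bounded as a tempered distribution and T*φ ∈ SAP(ℝ^d) for every φ ∈ C_c^∞(ℝ^d). -/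
set_option linter.unusedSectionVars false

open MeasureTheory Filter Metric Complex SchwartzMap
open scoped Topology ENNReal NNReal ComplexConjugate

noncomputable section

section Helpers

open scoped ContDiff

variable {E : Type*} [NormedAddCommGroup E] [InnerProductSpace ℝ E] [FiniteDimensional ℝ E]
  [MeasurableSpace E] [BorelSpace E]

lemma aux_cauchy {u : ℕ → SchwartzMap E ℂ} (hu : CauchySeq u) (k n : ℕ) (ε : ℝ) (hε : 0 < ε) :
    ∃ N, ∀ i ≥ N, ∀ j ≥ N, SchwartzMap.seminorm ℝ k n (u j - u i) < ε := by
  have h := cauchySeq_iff_tendsto.1 hu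
  rw [uniformity_eq_comap_nhds_zero, tendsto_comap_iff] at h
  have h2 := ((schwartz_withSeminorms ℝ E ℂ).tendsto_nhds _ _).1 h (k, n) ε hε
  rw [eventually_atTop] at h2
  obtain ⟨⟨a, b⟩, hab⟩ := h2
  refine ⟨max a b, fun i hi j hj => ?_⟩
  have := hab (i, j) ⟨le_trans (le_max_left _ _) hi, le_trans (le_max_right _ _) hj⟩
  simpa using this

lemma aux_iter_sub (f g : SchwartzMap E ℂ) (n : ℕ) (x : E) :
    iteratedFDeriv ℝ n (⇑(f - g)) x = iteratedFDeriv ℝ n f x - iteratedFDeriv ℝ n g x := by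
  have : (⇑(f - g)) = (⇑f - ⇑g) := by ext y; rfl
  rw [this]
  exact iteratedFDeriv_sub_apply (f.smooth n).contDiffAt (g.smooth n).contDiffAt

lemma aux_complete : CompleteSpace (SchwartzMap E ℂ) := by
  have : (uniformity (SchwartzMap E ℂ)).IsCountablyGenerated :=
    IsUniformAddGroup.uniformity_countably_generated
  refine UniformSpace.complete_of_cauchySeq_tendsto fun u hu => ?_
  have hc := aux_cauchy hu
  have hpt : ∀ n (x : E), ∃ l, Tendsto (fun j => iteratedFDeriv ℝ n (u j) x) atTop (𝓝 l) := by
    intro n x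
    apply cauchySeq_tendsto_of_complete
    rw [Metric.cauchySeq_iff]
    intro ε hε
    obtain ⟨N, hN⟩ := hc 0 n ε hε
    refine ⟨N, fun i hi j hj => ?_⟩
    rw [dist_eq_norm, ← aux_iter_sub]
    exact lt_of_le_of_lt (SchwartzMap.norm_iteratedFDeriv_le_seminorm ℝ _ n x) (hN j hj i hi)
  choose g hg using hpt
  -- weighted estimate
  have hw : ∀ k n (ε : ℝ), 0 < ε → ∃ N, ∀ j ≥ N, ∀ x : E,
      ‖x‖ ^ k * ‖iteratedFDeriv ℝ n (u j) x - g n x‖ ≤ ε := by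
    intro k n ε hε
    obtain ⟨N, hN⟩ := hc k n ε hε
    refine ⟨N, fun j hj x => ?_⟩
    have ht : Tendsto (fun i => ‖x‖ ^ k * ‖iteratedFDeriv ℝ n (u j) x - iteratedFDeriv ℝ n (u i) x‖)
        atTop (𝓝 (‖x‖ ^ k * ‖iteratedFDeriv ℝ n (u j) x - g n x‖)) :=
      ((hg n x).const_sub _).norm.const_mul _
    refine le_of_tendsto ht ?_
    filter_upwards [eventually_ge_atTop N] with i hi
    rw [← aux_iter_sub]
    exact (SchwartzMap.le_seminorm ℝ k n _ x).trans (hN i hi j hj).le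
  have hunif : ∀ n, TendstoUniformly (fun j x => iteratedFDeriv ℝ n (u j) x) (g n) atTop := by
    intro n
    rw [Metric.tendstoUniformly_iff]
    intro ε hε
    obtain ⟨N, hN⟩ := hw 0 n (ε / 2) (by positivity)
    filter_upwards [eventually_ge_atTop N] with j hj x
    have := hN j hj x
    rw [dist_comm, dist_eq_norm]
    simp only [pow_zero, one_mul] at this
    linarith
  have hderiv : ∀ n (x : E), HasFDerivAt (g n) ((g (n+1) x).curryLeft) x := by
    intro n x
    refine hasFDerivAt_of_tendstoUniformly (l := atTop)
      (f := fun j x => iteratedFDeriv ℝ n (u j) x)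
      (f' := fun j x => (iteratedFDeriv ℝ (n+1) (u j) x).curryLeft)
      (g' := fun x => (g (n+1) x).curryLeft) ?_ ?_ (hg n) x
    · have := (continuousMultilinearCurryLeftEquiv ℝ (fun _ : Fin (n+1) => E) ℂ).isometry.uniformContinuous.comp_tendstoUniformly (hunif (n+1))
      exact this
    · intro j y
      have hd := ((u j).smooth ⊤).ftaylorSeries.fderiv n (by exact_mod_cast ENat.natCast_lt_top n) y
      exact hd
  let f : E → ℂ := fun x => (g 0 x) 0
  have hT : HasFTaylorSeriesUpTo ∞ f (fun x n => g n x) := by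
    refine ⟨fun x => rfl, fun m _ x => hderiv m x, fun m _ => ?_⟩
    exact continuous_iff_continuousAt.2 fun x => (hderiv m x).continuousAt
  have hf : ContDiff ℝ ∞ f := hT.contDiff
  have hfg : ∀ n x, iteratedFDeriv ℝ n f x = g n x := by
    intro n x
    exact (hT.eq_iteratedFDeriv (m := n) (by exact_mod_cast le_top) x).symm
  let F : SchwartzMap E ℂ :=
    { toFun := f
      smooth' := hf
      decay' := by
        intro k n
        obtain ⟨N, hN⟩ := hw k n 1 one_pos
        refine ⟨SchwartzMap.seminorm ℝ k n (u N) + 1, fun x => ?_⟩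
        rw [hfg]
        have h1 := hN N le_rfl x
        have h2 := SchwartzMap.le_seminorm ℝ k n (u N) x
        have h3 : ‖g n x‖ ≤ ‖iteratedFDeriv ℝ n (u N) x‖ + ‖iteratedFDeriv ℝ n (u N) x - g n x‖ := by
          rw [norm_sub_rev]
          simpa using norm_add_le (iteratedFDeriv ℝ n (u N) x) (g n x - iteratedFDeriv ℝ n (u N) x)
        calc _ ≤ ‖x‖ ^ k * (‖iteratedFDeriv ℝ n (u N) x‖ + ‖iteratedFDeriv ℝ n (u N) x - g n x‖) := by
              gcongr
          _ ≤ _ := by rw [mul_add]; linarith }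
  refine ⟨F, ((schwartz_withSeminorms ℝ E ℂ).tendsto_nhds _ _).2 ?_⟩
  rintro ⟨k, n⟩ ε hε
  obtain ⟨N, hN⟩ := hw k n (ε / 2) (by positivity)
  filter_upwards [eventually_ge_atTop N] with j hj
  refine lt_of_le_of_lt (SchwartzMap.seminorm_le_bound ℝ k n _ (M := ε / 2) (by positivity) ?_)
    (by linarith)
  intro x
  rw [aux_iter_sub]
  have : iteratedFDeriv ℝ n (⇑F) x = g n x := hfg n x
  rw [this]
  exact hN j hj x

lemma aux_dense (ψ : SchwartzMap E ℂ) : ψ ∈ closure {φ : SchwartzMap E ℂ | IsTestFn φ} := by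
  let χ : ContDiffBump (0 : E) := ⟨1, 2, one_pos, one_lt_two⟩
  have hχs : ContDiff ℝ ∞ (χ : E → ℝ) := χ.contDiff
  have hχc : HasCompactSupport (χ : E → ℝ) := χ.hasCompactSupport
  let η : E → ℝ := fun x => χ x - 1
  have hηs : ContDiff ℝ ∞ η := hχs.sub contDiff_const
  have hηb : ∀ n : ℕ, ∃ C : ℝ, ∀ x, ‖iteratedFDeriv ℝ n η x‖ ≤ C := by
    intro n
    obtain ⟨C, hC⟩ := (hχc.toSchwartzMap hχs).decay 0 n
    refine ⟨C + 1, fun x => ?_⟩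
    have h1 : iteratedFDeriv ℝ n η x =
        iteratedFDeriv ℝ n (χ : E → ℝ) x - iteratedFDeriv ℝ n (fun _ : E => (1 : ℝ)) x :=
      iteratedFDeriv_sub_apply (hχs.of_le (by exact_mod_cast le_top)).contDiffAt
        contDiff_const.contDiffAt
    have h2 : ‖iteratedFDeriv ℝ n (fun _ : E => (1 : ℝ)) x‖ ≤ 1 := by
      rcases Nat.eq_zero_or_pos n with rfl | hn
      · simp
      · rw [iteratedFDeriv_const_of_ne hn.ne']; simp
    have h3 := hC.2 x
    simp only [pow_zero, one_mul] at h3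
    have h3' : ‖iteratedFDeriv ℝ n (χ : E → ℝ) x‖ ≤ C := h3
    rw [h1]
    exact (norm_sub_le _ _).trans (add_le_add h3' h2)
  choose C hC using hηb
  have hsm : ∀ R : ℝ, ContDiff ℝ ∞ (fun x : E => χ (R⁻¹ • x)) := fun R =>
    hχs.comp (contDiff_const_smul _)
  have hcs : ∀ m : ℕ, HasCompactSupport (fun x : E => χ ((m + 1 : ℝ)⁻¹ • x) • ψ x) := by
    intro m
    have : HasCompactSupport (fun x : E => χ ((m + 1 : ℝ)⁻¹ • x)) :=
      hχc.comp_smul (by positivity)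
    exact this.smul_right
  let φ : ℕ → SchwartzMap E ℂ := fun m =>
    (hcs m).toSchwartzMap ((hsm (m + 1)).smul (ψ.smooth ⊤))
  refine mem_closure_of_tendsto (f := φ) (b := atTop) ?_ (Eventually.of_forall fun m => hcs m)
  refine ((schwartz_withSeminorms ℝ E ℂ).tendsto_nhds _ _).2 ?_
  rintro ⟨k, n⟩ ε hε
  set B : ℝ := ∑ i ∈ Finset.range (n + 1), (n.choose i : ℝ) * |C i| *
    SchwartzMap.seminorm ℝ (k + 1) (n - i) ψ with hB
  have hB0 : 0 ≤ B := Finset.sum_nonneg fun i _ => by positivity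
  have hlim : Tendsto (fun m : ℕ => B / ((m : ℝ) + 1)) atTop (𝓝 0) :=
    tendsto_const_div_atTop_nhds_zero_nat B |>.comp (tendsto_add_atTop_nat 1) |>.congr
      (fun m => by simp)
  filter_upwards [hlim.eventually (gt_mem_nhds hε)] with m hm
  refine lt_of_le_of_lt (SchwartzMap.seminorm_le_bound ℝ k n _ (by positivity) ?_) hm
  intro x
  set R : ℝ := (m : ℝ) + 1 with hR
  have hR1 : 1 ≤ R := by rw [hR]; have : (0 : ℝ) ≤ m := Nat.cast_nonneg m; linarith
  have hR0 : 0 < R := by linarith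
  have heq : (⇑(φ m - ψ)) = fun y => η (R⁻¹ • y) • ψ y := by
    ext y
    change χ (R⁻¹ • y) • ψ y - ψ y = (χ (R⁻¹ • y) - 1) • ψ y
    rw [sub_smul, one_smul]
  rw [heq]
  have hηR : ContDiff ℝ ∞ (fun y : E => η (R⁻¹ • y)) := hηs.comp (contDiff_const_smul _)
  rcases lt_or_ge ‖x‖ R with hx | hx
  · have hz : (fun y => η (R⁻¹ • y) • ψ y) =ᶠ[𝓝 x] fun _ => (0 : ℂ) := by
      have ho : {y : E | ‖y‖ < R} ∈ 𝓝 x :=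
        (isOpen_lt continuous_norm continuous_const).mem_nhds hx
      filter_upwards [ho] with y hy
      have : χ (R⁻¹ • y) = 1 := by
        apply χ.one_of_mem_closedBall
        rw [mem_closedBall, dist_zero_right, norm_smul, norm_inv, Real.norm_of_nonneg hR0.le]
        change R⁻¹ * ‖y‖ ≤ 1
        rw [inv_mul_le_iff₀ hR0]
        simpa using le_of_lt hy
      simp [η, this]
    rw [(hz.iteratedFDeriv ℝ n).eq_of_nhds]
    have h0 : iteratedFDeriv ℝ n (fun _ : E => (0 : ℂ)) x = 0 := by
      rw [iteratedFDeriv_fun_zero]; rfl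
    rw [h0, norm_zero, mul_zero]
    positivity
  · have h1 := norm_iteratedFDeriv_smul_le (𝕜 := ℝ) hηR (ψ.smooth ⊤) x (n := n)
      (by exact_mod_cast le_top)
    have h2 : ∀ i, ‖iteratedFDeriv ℝ i (fun y : E => η (R⁻¹ • y)) x‖ ≤ |C i| := by
      intro i
      rw [iteratedFDeriv_comp_const_smul _ (hηs.of_le (by exact_mod_cast le_top))]
      simp only [norm_smul, norm_pow, norm_inv, Real.norm_of_nonneg hR0.le]
      have h3 : (R⁻¹) ^ i ≤ 1 := pow_le_one₀ (by positivity) (inv_le_one_of_one_le₀ hR1)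
      calc _ ≤ 1 * ‖iteratedFDeriv ℝ i η (R⁻¹ • x)‖ := by gcongr
        _ ≤ |C i| := by rw [one_mul]; exact (hC i _).trans (le_abs_self _)
    have h4 : ∀ i, ‖x‖ ^ k * ‖iteratedFDeriv ℝ (n - i) ψ x‖ ≤
        SchwartzMap.seminorm ℝ (k + 1) (n - i) ψ / R := by
      intro i
      rw [le_div_iff₀ hR0]
      calc _ ≤ ‖x‖ ^ k * ‖iteratedFDeriv ℝ (n - i) ψ x‖ * ‖x‖ := by gcongr
        _ = ‖x‖ ^ (k + 1) * ‖iteratedFDeriv ℝ (n - i) ψ x‖ := by ring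
        _ ≤ _ := SchwartzMap.le_seminorm ℝ (k + 1) (n - i) ψ x
    calc _ ≤ ‖x‖ ^ k * _ := mul_le_mul_of_nonneg_left h1 (by positivity)
      _ ≤ B / R := by
        rw [hB, Finset.mul_sum, Finset.sum_div]
        refine Finset.sum_le_sum fun i _ => ?_
        calc _ = (n.choose i : ℝ) * ‖iteratedFDeriv ℝ i (fun y : E => η (R⁻¹ • y)) x‖ *
              (‖x‖ ^ k * ‖iteratedFDeriv ℝ (n - i) ψ x‖) := by ring
          _ ≤ (n.choose i : ℝ) * |C i| * (SchwartzMap.seminorm ℝ (k + 1) (n - i) ψ / R) := by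
            gcongr
            · exact h2 i
            · exact h4 i
          _ = _ := by ring

lemma aux_approx (T : SchwartzMap E ℂ →L[ℂ] ℂ) (hT : TransBddTD T) (ψ : SchwartzMap E ℂ)
    (ε : ℝ) (hε : 0 < ε) :
    ∃ φ : SchwartzMap E ℂ, IsTestFn φ ∧ ∀ x, ‖convTD T ψ x - convTD T φ x‖ < ε := by
  have := aux_complete (E := E)
  have : (uniformity (SchwartzMap E ℂ)).IsCountablyGenerated :=
    IsUniformAddGroup.uniformity_countably_generated
  let L : E → (SchwartzMap E ℂ →L[ℝ] ℂ) := fun x =>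
    (T.restrictScalars ℝ).comp
      (SchwartzMap.compCLMOfAntilipschitz (K := 1) ℝ (hasTemperateGrowth_const_sub x)
        (isometry_const_sub x).antilipschitz)
  have hL : ∀ x φ, L x φ = convTD T φ x := fun x φ => rfl
  let p : E → Seminorm ℝ (SchwartzMap E ℂ) := fun x =>
    (normSeminorm ℝ ℂ).comp (L x).toLinearMap
  have hp : ∀ x φ, p x φ = ‖convTD T φ x‖ := fun x φ => rfl
  have hb : BddAbove (Set.range p) := by
    rw [Seminorm.bddAbove_range_iff]
    intro φ
    obtain ⟨C, hC⟩ := hT φ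
    exact ⟨C, by rintro _ ⟨x, rfl⟩; exact hC x⟩
  have hcont : Continuous (⨆ x, p x) := by
    have h := Seminorm.continuous_iSup p (fun x => (L x).continuous.norm) hb
    exact h
  have hcont' : Continuous (⇑(⨆ x, p x)) := by
    rw [Seminorm.coe_iSup_eq hb]
    exact hcont
  have hopen : IsOpen {φ : SchwartzMap E ℂ | (⨆ x, p x) (ψ - φ) < ε} :=
    isOpen_lt (hcont'.comp (continuous_const.sub continuous_id)) continuous_const
  obtain ⟨φ, hφ1, hφ2⟩ := mem_closure_iff.1 (aux_dense ψ) _ hopen (by simpa using hε)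
  refine ⟨φ, hφ2, fun x => ?_⟩
  have h1 : p x (ψ - φ) ≤ (⨆ x, p x) (ψ - φ) := by
    rw [Seminorm.iSup_apply hb]
    exact le_ciSup (f := fun y => p y (ψ - φ)) (Seminorm.bddAbove_range_iff.1 hb _) x
  have h2 : p x (ψ - φ) = ‖convTD T ψ x - convTD T φ x‖ := by
    change ‖L x (ψ - φ)‖ = _
    rw [map_sub, hL, hL]
  rw [← h2]
  exact lt_of_le_of_lt h1 hφ1

lemma aux_bohr (f : E → ℂ)
    (h : ∀ ε : ℝ, 0 < ε → ∃ g : E → ℂ, IsBohrAP g ∧ ∀ x, ‖f x - g x‖ < ε) : IsBohrAP f := by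
  refine ⟨?_, ?_, ?_⟩
  · rw [Metric.uniformContinuous_iff]
    intro ε hε
    obtain ⟨g, hg, hfg⟩ := h (ε / 3) (by positivity)
    obtain ⟨δ, hδ, hd⟩ := Metric.uniformContinuous_iff.1 hg.1 (ε / 3) (by positivity)
    refine ⟨δ, hδ, fun {a b} hab => ?_⟩
    have h1 := hfg a
    have h2 := hfg b
    have h3 := hd hab
    rw [← dist_eq_norm] at h1 h2
    rw [dist_comm] at h2
    have := dist_triangle4 (f a) (g a) (g b) (f b)
    linarith
  · obtain ⟨g, hg, hfg⟩ := h 1 one_pos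
    obtain ⟨C, hC⟩ := hg.2.1
    refine ⟨C + 1, fun x => ?_⟩
    have h1 : ‖f x‖ ≤ ‖f x - g x‖ + ‖g x‖ := by simpa using norm_add_le (f x - g x) (g x)
    have := hC x
    have := hfg x
    linarith
  · intro ε hε
    obtain ⟨g, hg, hfg⟩ := h (ε / 3) (by positivity)
    obtain ⟨r, hr⟩ := hg.2.2 (ε / 3) (by positivity)
    refine ⟨r, fun x => ?_⟩
    obtain ⟨a, ha, hxa⟩ := hr x
    refine ⟨a, fun y => ?_, hxa⟩
    have h1 := hfg (y - a)
    have h2 := hfg y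
    have h3 := ha y
    rw [← dist_eq_norm] at h1 h2 h3 ⊢
    rw [dist_comm] at h2
    have := dist_triangle4 (f (y - a)) (g (y - a)) (g y) (f y)
    linarith

end Helpers

/-- A tempered distribution is strongly almost periodic as a tempered
distribution iff it is translation bounded as a tempered distribution and `T*φ` is Bohr
almost periodic for every smooth compactly supported `φ`. -/
theorem sapTD_iff_transBddTD_and_sapD (d : ℕ)
    (T : SchwartzMap (EuclideanSpace ℝ (Fin d)) ℂ →L[ℂ] ℂ) :
    SAPTD T ↔ (TransBddTD T ∧
      ∀ φ : SchwartzMap (EuclideanSpace ℝ (Fin d)) ℂ, IsTestFn φ → IsBohrAP (convTD T φ)) := by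
  constructor
  · intro h
    exact ⟨fun ψ => (h ψ).2.1, fun φ _ => h φ⟩
  · rintro ⟨hb, hs⟩ ψ
    refine aux_bohr _ fun ε hε => ?_
    obtain ⟨φ, hφ, hx⟩ := aux_approx T hb ψ ε hε
    exact ⟨_, hs φ hφ, hx⟩
end
end

section
/- Let T be a strongly tempered measure on ℝ^d. Then its distributional Fourier transform T̂ is translation bounded as a tempered distribution, i.e., T̂*ψ is a bounded function for every Schwartz function ψ. -/
set_option linter.unusedSectionVars false

open MeasureTheory Filter Metric Complex SchwartzMap
open scoped Topology ENNReal NNReal ComplexConjugate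

noncomputable section

section Helpers

variable {E : Type*} [NormedAddCommGroup E] [InnerProductSpace ℝ E] [FiniteDimensional ℝ E]
  [MeasurableSpace E] [BorelSpace E]

lemma aux_temperate (μ : CMeasure E) (h : μ.IsStronglyTempered) :
    μ.tv.HasTemperateGrowth := by
  obtain ⟨C, a, h⟩ := h
  refine ⟨⟨⌈a⌉₊ + 2, ?_⟩⟩
  set N : ℕ := ⌈a⌉₊ + 2 with hN
  have haN : a - N ≤ -2 := by
    have := Nat.le_ceil a
    push_cast [hN]; linarith
  refine ⟨(by fun_prop : Measurable fun x : E => (1 + ‖x‖) ^ (-(N:ℝ))).aestronglyMeasurable, ?_⟩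
  have hs : Summable (fun m : ℕ => |C| * ((m:ℝ) + 1) ^ (-2:ℝ)) := by
    apply Summable.mul_left
    have := (summable_nat_add_iff 1).2 (Real.summable_nat_rpow.2 (by norm_num : (-2:ℝ) < -1))
    simpa using this
  calc ∫⁻ x, ‖(1 + ‖x‖) ^ (-(N:ℝ))‖ₑ ∂μ.tv
      ≤ ∫⁻ x, ∑' m : ℕ, (closedBall (0:E) ((m:ℝ) + 1)).indicator
          (fun _ => ENNReal.ofReal (((m:ℝ) + 1) ^ (-(N:ℝ)))) x ∂μ.tv := by
        apply lintegral_mono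
        intro x
        refine le_trans ?_ (ENNReal.le_tsum ⌊‖x‖⌋₊)
        have h1 := Nat.lt_floor_add_one ‖x‖
        have h2 := Nat.floor_le (norm_nonneg x)
        rw [Set.indicator_of_mem (by simpa using h1.le)]
        beta_reduce
        rw [Real.enorm_of_nonneg (by positivity)]
        apply ENNReal.ofReal_le_ofReal
        apply Real.rpow_le_rpow_of_nonpos (by positivity) (by linarith)
        simp
    _ = ∑' m : ℕ, ENNReal.ofReal (((m:ℝ) + 1) ^ (-(N:ℝ))) * μ.tv (closedBall 0 ((m:ℝ) + 1)) := by
        rw [lintegral_tsum]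
        · congr 1; ext m
          rw [lintegral_indicator_const measurableSet_closedBall]
        · intro m
          exact (measurable_const.indicator measurableSet_closedBall).aemeasurable
    _ ≤ ∑' m : ℕ, ENNReal.ofReal (|C| * ((m:ℝ) + 1) ^ (-2:ℝ)) := by
        apply ENNReal.tsum_le_tsum
        intro m
        have hm : (1:ℝ) ≤ (m:ℝ) + 1 := by linarith [(Nat.cast_nonneg m : (0:ℝ) ≤ m)]
        have hm0 : (0:ℝ) < (m:ℝ) + 1 := by linarith
        refine (mul_le_mul_right (h _ hm) _).trans ?_
        rw [← ENNReal.ofReal_mul (by positivity)]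
        apply ENNReal.ofReal_le_ofReal
        calc ((m:ℝ) + 1) ^ (-(N:ℝ)) * (C * ((m:ℝ) + 1) ^ a)
            = C * (((m:ℝ) + 1) ^ (a - N)) := by
              rw [sub_eq_add_neg, Real.rpow_add hm0]; ring
          _ ≤ |C| * ((m:ℝ) + 1) ^ (-2:ℝ) := by
              gcongr
              exact le_abs_self C
    _ < ⊤ := hs.tsum_ofReal_lt_top

lemma aux_fourier (x ξ : E) (ψ : SchwartzMap E ℂ) :
    ‖(SchwartzMap.fourierTransformCLM ℂ (transRefl x ψ)) ξ‖ =
      ‖(SchwartzMap.fourierTransformCLM ℂ ψ) (-ξ)‖ := by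
  rw [SchwartzMap.fourierTransformCLM_apply, SchwartzMap.fourierTransformCLM_apply,
    SchwartzMap.fourier_coe, SchwartzMap.fourier_coe, Real.fourier_eq, Real.fourier_eq]
  have h : ∀ v : E, Real.fourierChar (-(inner ℝ v ξ)) • (transRefl x ψ) v =
      (fun w : E => Real.fourierChar (-(inner ℝ x ξ)) •
        (Real.fourierChar (-(inner ℝ w (-ξ))) • ψ w)) (x - v) := by
    intro v
    simp only [transRefl_apply, smul_smul, ← AddChar.map_add_eq_mul]
    congr 2
    rw [inner_neg_right, inner_sub_left]; ring
  simp_rw [h]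
  rw [integral_sub_left_eq_self (fun w : E => Real.fourierChar (-(inner ℝ x ξ)) •
        (Real.fourierChar (-(inner ℝ w (-ξ))) • ψ w)) volume x]
  simp only [Circle.smul_def]
  rw [integral_smul, norm_smul, Circle.norm_coe, one_mul]

lemma aux_approx_s9 (φ : SchwartzMap E ℂ) :
    ∃ u : ℕ → SchwartzMap E ℂ, (∀ n, IsTestFn (u n)) ∧ (∀ n x, ‖u n x‖ ≤ ‖φ x‖) ∧
      Tendsto u atTop (𝓝 φ) := by
  let b : ContDiffBump (0 : E) := ⟨1, 2, one_pos, one_lt_two⟩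
  let χ : E → ℝ := b
  have hχ : ContDiff ℝ (⊤ : ℕ∞) χ := b.contDiff
  let h : E → ℝ := fun x => χ x - 1
  have hh : ContDiff ℝ (⊤ : ℕ∞) h := hχ.sub contDiff_const
  have hB : ∀ i : ℕ, ∃ B : ℝ, 0 ≤ B ∧ ∀ x, ‖iteratedFDeriv ℝ i h x‖ ≤ B := by
    intro i
    rcases i with _ | i
    · refine ⟨1, zero_le_one, fun x => ?_⟩
      have h0 : 0 ≤ χ x := b.nonneg
      have h1 : χ x ≤ 1 := b.le_one
      rw [norm_iteratedFDeriv_zero, Real.norm_eq_abs, abs_le]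
      constructor <;> simp only [h] <;> linarith
    · obtain ⟨B, hB⟩ := (b.hasCompactSupport.iteratedFDeriv (𝕜 := ℝ) (i+1)).exists_bound_of_continuous
        (hχ.continuous_iteratedFDeriv (by exact_mod_cast le_top))
      refine ⟨B, (norm_nonneg _).trans (hB 0), fun x => ?_⟩
      have : iteratedFDeriv ℝ (i+1) h x = iteratedFDeriv ℝ (i+1) χ x := by
        have := iteratedFDeriv_sub_apply (𝕜 := ℝ) (i := i+1) (x := x) (f := χ) (g := fun _ => (1:ℝ))
          (hχ.of_le (by exact_mod_cast le_top)).contDiffAt contDiff_const.contDiffAt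
        rw [iteratedFDeriv_succ_const] at this
        exact this.trans (by simp)
      rw [this]; exact hB x
  choose B hB0 hB using hB
  let c : ℕ → ℝ := fun n => ((n:ℝ) + 1)⁻¹
  have hc0 : ∀ n, 0 < c n := fun n => by positivity
  have hc1 : ∀ n, c n ≤ 1 := fun n => by
    apply inv_le_one_of_one_le₀; linarith [(Nat.cast_nonneg n : (0:ℝ) ≤ n)]
  have hcs : ∀ n, HasCompactSupport (fun x : E => χ (c n • x) • φ x) := by
    intro n
    have : HasCompactSupport (fun x : E => χ (c n • x)) :=
      b.hasCompactSupport.comp_smul (hc0 n).ne'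
    exact this.smul_right
  have hsm : ∀ n, ContDiff ℝ (⊤ : ℕ∞) (fun x : E => χ (c n • x) • φ x) := fun n =>
    (hχ.comp (contDiff_const.smul contDiff_id)).smul (φ.smooth _)
  let u : ℕ → SchwartzMap E ℂ := fun n => (hcs n).toSchwartzMap (hsm n)
  have hu : ∀ n x, u n x = χ (c n • x) • φ x := fun n x => rfl
  refine ⟨u, fun n => hcs n, fun n x => ?_, ?_⟩
  · rw [hu, norm_smul]
    have h0 : 0 ≤ χ (c n • x) := b.nonneg
    have h1 : χ (c n • x) ≤ 1 := b.le_one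
    rw [Real.norm_of_nonneg h0]
    exact mul_le_of_le_one_left (norm_nonneg _) h1
  · rw [(schwartz_withSeminorms ℝ E ℂ).tendsto_nhds]
    rintro ⟨k, l⟩ ε hε
    set M : ℝ := ∑ i ∈ Finset.range (l+1), (l.choose i : ℝ) * B i *
      SchwartzMap.seminorm ℝ (k+1) (l-i) φ with hM
    have hM0 : 0 ≤ M := Finset.sum_nonneg fun i _ => by
      have := hB0 i
      have := apply_nonneg (SchwartzMap.seminorm ℝ (k+1) (l-i)) φ
      positivity
    have key : ∀ n, SchwartzMap.seminorm ℝ k l (u n - φ) ≤ c n * M := by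
      intro n
      apply SchwartzMap.seminorm_le_bound ℝ k l _ (mul_nonneg (hc0 n).le hM0)
      intro x
      have hfun : ⇑(u n - φ) = fun x => h (c n • x) • φ x := by
        ext y
        simp only [sub_apply, hu, h, sub_smul, one_smul]
      rw [hfun]
      by_cases hx : ‖x‖ < (n:ℝ) + 1
      · have hev : (fun x => h (c n • x) • φ x) =ᶠ[𝓝 x] fun _ => (0:ℂ) := by
          filter_upwards [(isOpen_lt continuous_norm continuous_const).mem_nhds hx] with y hy
          have : χ (c n • y) = 1 := by
            apply b.one_of_mem_closedBall
            rw [mem_closedBall_zero_iff, norm_smul, Real.norm_of_nonneg (hc0 n).le]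
            change ((n:ℝ) + 1)⁻¹ * ‖y‖ ≤ 1
            rw [inv_mul_le_iff₀ (by positivity)]
            simpa using (le_of_lt hy)
          simp [h, this]
        rw [(Filter.EventuallyEq.iteratedFDeriv (𝕜 := ℝ) hev l).eq_of_nhds]
        have : iteratedFDeriv ℝ l (fun _ : E => (0:ℂ)) x = 0 := by
          simp
        rw [this, norm_zero, mul_zero]
        exact mul_nonneg (hc0 n).le hM0
      · push Not at hx
        have hcx : 1 ≤ c n * ‖x‖ := by
          change 1 ≤ ((n:ℝ) + 1)⁻¹ * ‖x‖
          rw [le_inv_mul_iff₀ (by positivity)]; simpa using hx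
        have hleib := norm_iteratedFDeriv_smul_le (𝕜 := ℝ) (f := fun x => h (c n • x)) (g := φ)
          (N := ((⊤ : ℕ∞) : WithTop ℕ∞)) (hh.comp (contDiff_const.smul contDiff_id))
          (φ.smooth _) (x := x) (n := l) (by exact_mod_cast le_top)
        have hsc : ∀ i, ‖iteratedFDeriv ℝ i (fun x => h (c n • x)) x‖ ≤ B i := by
          intro i
          rw [iteratedFDeriv_comp_const_smul (𝕜 := ℝ) (f := h) (i := i) (c n) (hh.of_le (by exact_mod_cast le_top))]
          simp only [norm_smul, norm_pow, Real.norm_of_nonneg (hc0 n).le]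
          exact (mul_le_of_le_one_left (norm_nonneg _) (pow_le_one₀ (hc0 n).le (hc1 n))).trans
            (hB i _)
        calc ‖x‖ ^ k * ‖iteratedFDeriv ℝ l (fun x => h (c n • x) • φ x) x‖
            ≤ (c n * ‖x‖) * (‖x‖ ^ k * ‖iteratedFDeriv ℝ l (fun x => h (c n • x) • φ x) x‖) :=
              le_mul_of_one_le_left (by positivity) hcx
          _ ≤ (c n * ‖x‖) * (‖x‖ ^ k * ∑ i ∈ Finset.range (l+1), (l.choose i : ℝ) *
                ‖iteratedFDeriv ℝ i (fun x => h (c n • x)) x‖ * ‖iteratedFDeriv ℝ (l-i) φ x‖) := by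
              have := (hc0 n).le
              gcongr
          _ = c n * ∑ i ∈ Finset.range (l+1), (l.choose i : ℝ) *
                ‖iteratedFDeriv ℝ i (fun x => h (c n • x)) x‖ *
                  (‖x‖ ^ (k+1) * ‖iteratedFDeriv ℝ (l-i) φ x‖) := by
              rw [mul_assoc, ← mul_assoc ‖x‖, Finset.mul_sum]
              congr 1
              apply Finset.sum_congr rfl
              intros; ring
          _ ≤ c n * M := by
              refine mul_le_mul_of_nonneg_left (Finset.sum_le_sum fun i _ => ?_) (hc0 n).le
              have := hB0 i
              gcongr
              · exact hsc i
              · exact SchwartzMap.le_seminorm ℝ _ _ _ _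
    have hlim : Tendsto (fun n => c n * M) atTop (𝓝 0) := by
      have := (tendsto_one_div_add_atTop_nhds_zero_nat (𝕜 := ℝ)).mul_const M
      simpa [c] using this
    filter_upwards [hlim.eventually (gt_mem_nhds hε)] with n hn
    exact (key n).trans_lt hn

lemma aux_bound (μ : CMeasure E) (T : SchwartzMap E ℂ →L[ℂ] ℂ) (hT : μ.Agrees T)
    (hST : μ.IsStronglyTempered) (φ : SchwartzMap E ℂ) : ‖T φ‖ ≤ ∫ x, ‖φ x‖ ∂μ.tv := by
  have := aux_temperate μ hST
  obtain ⟨u, hu1, hu2, hu3⟩ := aux_approx_s9 φ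
  refine le_of_tendsto ((T.continuous.tendsto φ).comp hu3).norm (Eventually.of_forall fun n => ?_)
  simp only [Function.comp]
  rw [hT _ (hu1 n)]
  unfold CMeasure.pairing
  refine norm_integral_le_of_norm_le (φ.integrable (μ := μ.tv)).norm ?_
  filter_upwards [μ.density_norm] with x hx
  rw [norm_mul, hx, mul_one]
  exact hu2 n x

end Helpers

/-- The Fourier transform of a strongly tempered measure on `ℝ^d` is
translation bounded as a tempered distribution. -/
theorem fourier_transBddTD_of_stronglyTempered (d : ℕ)
    (μ : CMeasure (EuclideanSpace ℝ (Fin d)))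
    (T : SchwartzMap (EuclideanSpace ℝ (Fin d)) ℂ →L[ℂ] ℂ)
    (hμT : μ.Agrees T)
    (hST : μ.IsStronglyTempered) :
    TransBddTD (fourierTD T) := by
  intro ψ
  refine ⟨∫ ξ, ‖(SchwartzMap.fourierTransformCLM ℂ ψ) (-ξ)‖ ∂μ.tv, fun x => ?_⟩
  refine (aux_bound μ T hμT hST _).trans_eq ?_
  exact integral_congr_ae (Eventually.of_forall fun ξ => aux_fourier x ξ ψ)
end
end

section
/- Let T be a strongly tempered measure on ℝ^d. If T is a pure-point measure, then its distributional Fourier transform T̂ is strongly almost periodic as a tempered distribution, i.e., T̂*ψ is a Bohr almost periodic function for every Schwartz function ψ. -/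
set_option linter.unusedSectionVars false

open MeasureTheory Filter Metric Complex SchwartzMap
open scoped Topology ENNReal NNReal ComplexConjugate

noncomputable section

section Aux

variable {E : Type*} [NormedAddCommGroup E] [InnerProductSpace ℝ E] [FiniteDimensional ℝ E]
  [MeasurableSpace E] [BorelSpace E]

lemma exists_testFn_tendsto (φ : SchwartzMap E ℂ) :
    ∃ u : ℕ → SchwartzMap E ℂ, (∀ n, IsTestFn (u n)) ∧ Tendsto u atTop (𝓝 φ) ∧
      (∀ n x, ‖u n x‖ ≤ ‖φ x‖) ∧ ∀ x, Tendsto (fun n => u n x) atTop (𝓝 (φ x)) := by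
  let χ : ContDiffBump (0 : E) := ⟨1, 2, one_pos, one_lt_two⟩
  let c : ℕ → ℝ := fun n => 1 / ((n : ℝ) + 1)
  have hc0 : ∀ n, 0 < c n := fun n => Nat.one_div_pos_of_nat
  have hc1 : ∀ n, c n ≤ 1 := fun n => by
    simp only [c]; rw [div_le_one (by positivity)]; linarith [Nat.cast_nonneg (α := ℝ) n]
  have hcT : Tendsto c atTop (𝓝 0) := tendsto_one_div_add_atTop_nhds_zero_nat
  have hχs : ContDiff ℝ (⊤ : ℕ∞) χ := χ.contDiff
  have hηs : ContDiff ℝ (⊤ : ℕ∞) (fun x => 1 - χ x) := contDiff_const.sub hχs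
  -- compact supports
  have hcs : ∀ n, HasCompactSupport (fun x : E => χ (c n • x)) := fun n =>
    χ.hasCompactSupport.comp_smul (hc0 n).ne'
  have hsm : ∀ n, ContDiff ℝ (⊤ : ℕ∞) (fun x : E => χ (c n • x)) := fun n =>
    hχs.comp (contDiff_const_smul _)
  have htg : ∀ n, Function.HasTemperateGrowth (fun x : E => χ (c n • x)) := fun n =>
    (hcs n).hasTemperateGrowth (hsm n)
  let u : ℕ → SchwartzMap E ℂ := fun n => SchwartzMap.smulLeftCLM ℂ (fun x : E => χ (c n • x)) φ
  have hu : ∀ n x, u n x = χ (c n • x) • φ x := fun n x =>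
    SchwartzMap.smulLeftCLM_apply_apply (htg n) φ x
  -- derivative bounds
  have hB : ∀ i : ℕ, ∃ C, ∀ x, ‖iteratedFDeriv ℝ i (fun x => 1 - χ x) x‖ ≤ C := by
    intro i
    have h1 : ∃ C, ∀ x, ‖iteratedFDeriv ℝ i χ x‖ ≤ C :=
      (χ.hasCompactSupport.iteratedFDeriv i).exists_bound_of_continuous
        (hχs.continuous_iteratedFDeriv (mod_cast le_top))
    obtain ⟨C, hC⟩ := h1
    have h2 : ∃ C, ∀ x : E, ‖iteratedFDeriv ℝ i (fun _ : E => (1 : ℝ)) x‖ ≤ C := by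
      rcases Nat.eq_zero_or_pos i with rfl | hi
      · exact ⟨1, fun x => by simp⟩
      · refine ⟨0, fun x => ?_⟩
        rw [iteratedFDeriv_const_of_ne hi.ne']; simp
    obtain ⟨C', hC'⟩ := h2
    refine ⟨C' + C, fun x => ?_⟩
    have : iteratedFDeriv ℝ i (fun x => 1 - χ x) x =
        iteratedFDeriv ℝ i (fun _ : E => (1 : ℝ)) x - iteratedFDeriv ℝ i χ x :=
      iteratedFDeriv_sub_apply (f := fun _ : E => (1 : ℝ)) (g := χ) contDiff_const.contDiffAt
        (hχs.contDiffAt.of_le (mod_cast le_top))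
    rw [this]
    exact (norm_sub_le _ _).trans (add_le_add (hC' x) (hC x))
  choose B hB using hB
  have hBn : ∀ n i x, ‖iteratedFDeriv ℝ i (fun x : E => 1 - χ (c n • x)) x‖ ≤ B i := by
    intro n i x
    have := iteratedFDeriv_comp_const_smul (𝕜 := ℝ) (i := i) (f := fun x : E => 1 - χ x) (c n)
      (hηs.of_le (mod_cast le_top))
    have h2 := congrFun this x
    rw [h2, norm_smul, norm_pow, Real.norm_of_nonneg (hc0 n).le]
    calc _ ≤ 1 * ‖iteratedFDeriv ℝ i (fun x => 1 - χ x) (c n • x)‖ := by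
          gcongr
          exact pow_le_one₀ (hc0 n).le (hc1 n)
      _ ≤ B i := by rw [one_mul]; exact hB i _
  refine ⟨u, fun n => ?_, ?_, fun n x => ?_, fun x => ?_⟩
  · refine HasCompactSupport.intro (hcs n) (fun x hx => ?_)
    rw [hu, image_eq_zero_of_notMem_tsupport hx, zero_smul]
  · rw [(schwartz_withSeminorms ℝ E ℂ).tendsto_nhds]
    rintro ⟨k, m⟩ ε hε
    let M : ℝ := ∑ i ∈ Finset.range (m + 1), (m.choose i : ℝ) * B i *
      SchwartzMap.seminorm ℝ (k + 1) (m - i) φ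
    have hB0 : ∀ i, 0 ≤ B i := fun i => (norm_nonneg _).trans (hB i 0)
    have hM : 0 ≤ M := Finset.sum_nonneg fun i _ =>
      mul_nonneg (mul_nonneg (by positivity) (hB0 i)) (apply_nonneg _ _)
    have key : ∀ n, SchwartzMap.seminorm ℝ k m (u n - φ) ≤ c n * M := by
      intro n
      rw [← map_neg_eq_map, neg_sub]
      refine SchwartzMap.seminorm_le_bound ℝ k m _ (mul_nonneg (hc0 n).le hM) (fun x => ?_)
      have hcoe : ⇑(φ - u n) = fun x : E => (1 - χ (c n • x)) • φ x := by
        funext y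
        rw [sub_apply, hu, sub_smul, one_smul]
      rw [hcoe]
      by_cases hx : c n * ‖x‖ < 1
      · have hz : (fun x : E => (1 - χ (c n • x)) • φ x) =ᶠ[𝓝 x] fun _ => (0 : ℂ) := by
          have : ∀ᶠ y in 𝓝 x, c n * ‖y‖ < 1 :=
            (continuous_const.mul continuous_norm).continuousAt.eventually_lt
              continuousAt_const hx
          filter_upwards [this] with y hy
          rw [χ.one_of_mem_closedBall, sub_self, zero_smul]
          rw [mem_closedBall_zero_iff, norm_smul, Real.norm_of_nonneg (hc0 n).le]
          exact hy.le
        have := (hz.iteratedFDeriv ℝ m).eq_of_nhds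
        rw [this]
        have h0 : iteratedFDeriv ℝ m (fun _ : E => (0 : ℂ)) x = 0 := by
          simp
        rw [h0, norm_zero, mul_zero]
        exact mul_nonneg (hc0 n).le hM
      · push Not at hx
        have h1 := norm_iteratedFDeriv_smul_le (𝕜 := ℝ) (n := m)
          (f := fun x : E => 1 - χ (c n • x)) (g := ⇑φ) (N := ((⊤ : ℕ∞) : WithTop ℕ∞))
          (contDiff_const.sub (hsm n)) (φ.smooth ⊤) x (mod_cast le_top)
        calc _ ≤ ‖x‖ ^ k * ∑ i ∈ Finset.range (m + 1), (m.choose i : ℝ) *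
              ‖iteratedFDeriv ℝ i (fun x : E => 1 - χ (c n • x)) x‖ *
              ‖iteratedFDeriv ℝ (m - i) φ x‖ := by gcongr
          _ ≤ (c n * ‖x‖) * (‖x‖ ^ k * ∑ i ∈ Finset.range (m + 1), (m.choose i : ℝ) *
              ‖iteratedFDeriv ℝ i (fun x : E => 1 - χ (c n • x)) x‖ *
              ‖iteratedFDeriv ℝ (m - i) φ x‖) :=
              le_mul_of_one_le_left (by positivity) hx
          _ = c n * ∑ i ∈ Finset.range (m + 1), (m.choose i : ℝ) *
              ‖iteratedFDeriv ℝ i (fun x : E => 1 - χ (c n • x)) x‖ *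
              (‖x‖ ^ (k + 1) * ‖iteratedFDeriv ℝ (m - i) φ x‖) := by
              rw [mul_assoc, Finset.mul_sum, Finset.mul_sum]
              congr 1
              refine Finset.sum_congr rfl fun i _ => ?_
              ring
          _ ≤ c n * M := by
              refine mul_le_mul_of_nonneg_left (Finset.sum_le_sum fun i _ => ?_) (hc0 n).le
              refine mul_le_mul (mul_le_mul_of_nonneg_left (hBn n i x) (by positivity))
                (SchwartzMap.le_seminorm ℝ _ _ _ _) (by positivity)
                (mul_nonneg (by positivity) (hB0 i))
    have hl : Tendsto (fun n => c n * M) atTop (𝓝 0) := by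
      simpa using hcT.mul_const M
    filter_upwards [hl.eventually_lt_const hε] with n hn
    exact (key n).trans_lt hn
  · rw [hu, norm_smul, Real.norm_of_nonneg χ.nonneg]
    exact mul_le_of_le_one_left (norm_nonneg _) χ.le_one
  · simp_rw [hu]
    have h1 : Tendsto (fun n => χ (c n • x)) atTop (𝓝 (χ ((0 : ℝ) • x))) :=
      (hχs.continuous.tendsto _).comp (hcT.smul_const x)
    have h2 : χ ((0 : ℝ) • x) = 1 := by
      apply χ.one_of_mem_closedBall
      simp [χ]
    rw [h2] at h1
    simpa using h1.smul_const (φ x)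

lemma CMeasure.IsStronglyTempered.hasTemperateGrowth {μ : CMeasure E}
    (h : μ.IsStronglyTempered) : μ.tv.HasTemperateGrowth := by
  obtain ⟨C, a, h⟩ := h
  let N := ⌈a⌉₊
  have hb : ∀ n : ℕ, μ.tv (Metric.closedBall 0 ((n : ℝ) + 1)) ≤
      ENNReal.ofReal (|C| * ((n : ℝ) + 1) ^ N) := by
    intro n
    have h1 : (1 : ℝ) ≤ (n : ℝ) + 1 := by linarith [Nat.cast_nonneg (α := ℝ) n]
    refine (h _ h1).trans (ENNReal.ofReal_le_ofReal ?_)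
    refine mul_le_mul (le_abs_self C) ?_ (by positivity) (abs_nonneg C)
    rw [← Real.rpow_natCast]
    exact Real.rpow_le_rpow_of_exponent_le h1 (Nat.le_ceil a)
  refine ⟨⟨N + 2, ?_⟩⟩
  have hcont : Continuous (fun x : E => (1 + ‖x‖) ^ (-((N + 2 : ℕ) : ℝ))) := by
    refine Continuous.rpow_const (by fun_prop) (fun x => Or.inl ?_)
    positivity
  refine ⟨hcont.aestronglyMeasurable, ?_⟩
  rw [hasFiniteIntegral_iff_norm]
  let A : ℕ → Set E := fun n => Metric.closedBall 0 ((n : ℝ) + 1) \ Metric.ball 0 (n : ℝ)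
  have hA : (⋃ n, A n) = Set.univ := by
    refine Set.eq_univ_of_forall fun x => Set.mem_iUnion.2 ⟨⌊‖x‖⌋₊, ?_, ?_⟩
    · simpa using (Nat.lt_floor_add_one ‖x‖).le
    · simpa using Nat.floor_le (norm_nonneg x)
  rw [← setLIntegral_univ, ← hA]
  refine (lintegral_iUnion_le _ _).trans_lt ?_
  have hterm : ∀ n, ∫⁻ x in A n, ENNReal.ofReal ‖(1 + ‖x‖) ^ (-((N + 2 : ℕ) : ℝ))‖ ∂μ.tv ≤
      ENNReal.ofReal (|C| * (1 / ((n : ℝ) + 1) ^ 2)) := by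
    intro n
    have hm : MeasurableSet (A n) := measurableSet_closedBall.diff measurableSet_ball
    calc _ ≤ ∫⁻ x in A n, ENNReal.ofReal (1 / ((n : ℝ) + 1) ^ (N + 2)) ∂μ.tv := by
          refine setLIntegral_mono' hm fun x hx => ENNReal.ofReal_le_ofReal ?_
          rw [Real.norm_of_nonneg (by positivity), Real.rpow_neg (by positivity),
            Real.rpow_natCast, ← one_div]
          have : (n : ℝ) ≤ ‖x‖ := by simpa using hx.2
          rw [add_comm 1 ‖x‖]
          gcongr
      _ = ENNReal.ofReal (1 / ((n : ℝ) + 1) ^ (N + 2)) * μ.tv (A n) := by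
          rw [setLIntegral_const]
      _ ≤ ENNReal.ofReal (1 / ((n : ℝ) + 1) ^ (N + 2)) *
            ENNReal.ofReal (|C| * ((n : ℝ) + 1) ^ N) := by
          gcongr
          exact (measure_mono Set.sdiff_subset).trans (hb n)
      _ = _ := by
          rw [← ENNReal.ofReal_mul (by positivity)]
          congr 1
          field_simp
          try ring
  refine (ENNReal.tsum_le_tsum hterm).trans_lt ?_
  have hs : Summable (fun n : ℕ => |C| * (1 / ((n : ℝ) + 1) ^ 2)) := by
    refine Summable.mul_left _ ?_
    have := (summable_nat_add_iff 1).2 (Real.summable_one_div_nat_pow.2 one_lt_two)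
    simpa using this
  rw [← ENNReal.ofReal_tsum_of_nonneg (fun n => by positivity) hs]
  exact ENNReal.ofReal_lt_top

lemma CMeasure.integrable_mul_density (μ : CMeasure E) [μ.tv.HasTemperateGrowth]
    (φ : SchwartzMap E ℂ) : Integrable (fun x => φ x * μ.density x) μ.tv := by
  refine (φ.integrable (μ := μ.tv)).mono
    (φ.continuous.aestronglyMeasurable.mul μ.density_meas.aestronglyMeasurable) ?_
  filter_upwards [μ.density_norm] with x hx
  rw [norm_mul, hx, mul_one]

lemma CMeasure.Agrees.eq_pairing {μ : CMeasure E} [μ.tv.HasTemperateGrowth]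
    {T : SchwartzMap E ℂ →L[ℂ] ℂ} (h : μ.Agrees T) (φ : SchwartzMap E ℂ) :
    T φ = μ.pairing φ := by
  obtain ⟨u, hu1, hu2, hu3, hu4⟩ := exists_testFn_tendsto φ
  have h1 : Tendsto (fun n => T (u n)) atTop (𝓝 (T φ)) := (T.continuous.tendsto φ).comp hu2
  have h2 : Tendsto (fun n => μ.pairing (u n)) atTop (𝓝 (μ.pairing φ)) := by
    refine tendsto_integral_of_dominated_convergence (fun x => ‖φ x‖)
      (fun n => (μ.integrable_mul_density (u n)).aestronglyMeasurable)
      (φ.integrable (μ := μ.tv)).norm (fun n => ?_) ?_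
    · filter_upwards [μ.density_norm] with x hx
      rw [norm_mul, hx, mul_one]
      exact hu3 n x
    · exact Eventually.of_forall fun x => (hu4 x).mul_const _
  refine tendsto_nhds_unique h1 ?_
  simpa only [h _ (hu1 _)] using h2

lemma fourier_transRefl (x ξ : E) (ψ : SchwartzMap E ℂ) :
    (SchwartzMap.fourierTransformCLM ℂ (transRefl x ψ)) ξ =
      (Real.fourierChar (-(inner ℝ x ξ)) : ℂ) *
        (FourierTransformInv.fourierInv ψ : SchwartzMap E ℂ) ξ := by
  rw [SchwartzMap.fourierTransformCLM_apply, SchwartzMap.fourier_coe, SchwartzMap.fourierInv_coe,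
    Real.fourier_eq, Real.fourierInv_eq, ← integral_const_mul,
    ← integral_sub_left_eq_self _ _ x]
  refine integral_congr_ae (Eventually.of_forall fun v => ?_)
  simp only [transRefl_apply, sub_sub_cancel, Circle.smul_def, smul_eq_mul]
  rw [← mul_assoc, ← Circle.coe_mul, ← AddChar.map_add_eq_mul]
  congr 4
  rw [inner_sub_left]
  ring

lemma relDense_finite_chars (F : Finset E) {δ : ℝ} (hδ : 0 < δ) :
    IsRelativelyDense {t : E | ∀ ξ ∈ F,
      ‖(Real.fourierChar (inner ℝ t ξ) : ℂ) - 1‖ < δ} := by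
  let Φ : E → (F → Circle) := fun t ξ => Real.fourierChar (inner ℝ t (ξ : E))
  have htb : TotallyBounded (Set.range Φ) :=
    (isCompact_univ.totallyBounded).subset (Set.subset_univ _)
  rw [totallyBounded_iff_subset] at htb
  obtain ⟨s, hs, hsf, hcov⟩ := htb {p | dist p.1 p.2 < δ} (Metric.dist_mem_uniformity hδ)
  have : ∃ s' : Set E, s'.Finite ∧ Φ '' s' = s := by
    choose f hf using hs
    refine ⟨Set.range (fun y : s => f y.2), ?_, ?_⟩
    · have := hsf.to_subtype
      exact Set.finite_range _
    · ext y
      constructor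
      · rintro ⟨_, ⟨z, rfl⟩, rfl⟩
        rw [hf]
        exact z.2
      · intro hy
        exact ⟨f hy, ⟨⟨y, hy⟩, rfl⟩, hf hy⟩
  obtain ⟨s', hs'f, rfl⟩ := this
  obtain ⟨r, hr⟩ := hs'f.isBounded.exists_norm_le
  refine ⟨r, fun x => ?_⟩
  have hx := hcov ⟨x, rfl⟩
  simp only [Set.mem_iUnion] at hx
  obtain ⟨_, ⟨t, ht, rfl⟩, hxt⟩ := hx
  refine ⟨x - t, fun ξ hξ => ?_, by simpa using hr t ht⟩
  have h1 : dist (Φ x ⟨ξ, hξ⟩) (Φ t ⟨ξ, hξ⟩) < δ := (dist_le_pi_dist _ _ _).trans_lt hxt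
  change dist (Real.fourierChar (inner ℝ x ξ) : ℂ) (Real.fourierChar (inner ℝ t ξ) : ℂ) < δ at h1
  rw [dist_eq_norm] at h1
  have h2 : (Real.fourierChar (inner ℝ x ξ) : ℂ) =
      (Real.fourierChar (inner ℝ (x - t) ξ) : ℂ) * (Real.fourierChar (inner ℝ t ξ) : ℂ) := by
    rw [← Circle.coe_mul, ← AddChar.map_add_eq_mul, ← inner_add_left, sub_add_cancel]
  rw [h2, ← sub_one_mul, norm_mul, Circle.norm_coe, mul_one] at h1
  exact h1

lemma isBohrAP_of_purePoint (ν : Measure E) (S : Set E) (hS : S.Countable) (hν : ν Sᶜ = 0)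
    (g : E → ℂ) (hg : Integrable g ν) :
    IsBohrAP (fun x => ∫ ξ, (Real.fourierChar (-(inner ℝ x ξ)) : ℂ) * g ξ ∂ν) := by
  have hcc : ∀ x : E, Continuous (fun ξ : E => (Real.fourierChar (inner ℝ x ξ) : ℂ)) := fun x =>
    continuous_subtype_val.comp (Real.continuous_fourierChar.comp (by fun_prop))
  have hint : ∀ x : E, Integrable (fun ξ => (Real.fourierChar (inner ℝ x ξ) : ℂ) * g ξ) ν := by
    intro x
    refine hg.mono ((hcc x).aestronglyMeasurable.mul hg.aestronglyMeasurable)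
      (Eventually.of_forall fun ξ => ?_)
    rw [norm_mul, Circle.norm_coe, one_mul]
  have hint' : ∀ x : E, Integrable (fun ξ => (Real.fourierChar (-(inner ℝ x ξ)) : ℂ) * g ξ) ν := by
    intro x
    simpa [inner_neg_left] using hint (-x)
  let N : E → ℝ := fun t => ∫ ξ, ‖(Real.fourierChar (inner ℝ t ξ) : ℂ) - 1‖ * ‖g ξ‖ ∂ν
  have hb2 : ∀ t ξ : E, ‖(Real.fourierChar (inner ℝ t ξ) : ℂ) - 1‖ ≤ 2 := fun t ξ => by
    refine (norm_sub_le _ _).trans ?_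
    rw [Circle.norm_coe, norm_one]; norm_num
  have hNint : ∀ t : E, Integrable
      (fun ξ => ‖(Real.fourierChar (inner ℝ t ξ) : ℂ) - 1‖ * ‖g ξ‖) ν := by
    intro t
    refine (hg.norm.const_mul 2).mono
      ((((hcc t).sub continuous_const).norm.aestronglyMeasurable).mul
        hg.aestronglyMeasurable.norm) (Eventually.of_forall fun ξ => ?_)
    rw [norm_mul, norm_mul, norm_norm, norm_norm, Real.norm_of_nonneg (zero_le_two)]
    exact mul_le_mul_of_nonneg_right (hb2 t ξ) (norm_nonneg _)
  have hdiff : ∀ x t : E,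
      ‖(∫ ξ, (Real.fourierChar (-(inner ℝ (x - t) ξ)) : ℂ) * g ξ ∂ν) -
        ∫ ξ, (Real.fourierChar (-(inner ℝ x ξ)) : ℂ) * g ξ ∂ν‖ ≤ N t := by
    intro x t
    rw [← integral_sub (hint' _) (hint' _)]
    refine (norm_integral_le_integral_norm _).trans (le_of_eq ?_)
    refine integral_congr_ae (Eventually.of_forall fun ξ => ?_)
    have h2 : (Real.fourierChar (-(inner ℝ (x - t) ξ)) : ℂ) =
      (Real.fourierChar (-(inner ℝ x ξ)) : ℂ) * (Real.fourierChar (inner ℝ t ξ) : ℂ) := by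
      rw [← Circle.coe_mul, ← AddChar.map_add_eq_mul, inner_sub_left]
      congr 2
      ring
    have h3 : (Real.fourierChar (-(inner ℝ (x - t) ξ)) : ℂ) * g ξ -
        (Real.fourierChar (-(inner ℝ x ξ)) : ℂ) * g ξ =
        (Real.fourierChar (-(inner ℝ x ξ)) : ℂ) *
          (((Real.fourierChar (inner ℝ t ξ) : ℂ) - 1) * g ξ) := by
      rw [h2]; ring
    simp only
    rw [h3, norm_mul, Circle.norm_coe, one_mul, norm_mul]
  have hN0 : Tendsto N (𝓝 0) (𝓝 0) := by
    have : Tendsto N (𝓝 0) (𝓝 (∫ ξ, (0 : ℝ) ∂ν)) := by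
      refine tendsto_integral_filter_of_dominated_convergence (fun ξ => 2 * ‖g ξ‖)
        (Eventually.of_forall fun t => (hNint t).aestronglyMeasurable)
        (Eventually.of_forall fun t => Eventually.of_forall fun ξ => ?_)
        (hg.norm.const_mul 2) (Eventually.of_forall fun ξ => ?_)
      · rw [norm_mul, norm_norm, norm_norm]
        exact mul_le_mul_of_nonneg_right (hb2 t ξ) (norm_nonneg _)
      · have hc : Continuous (fun t : E =>
            ‖(Real.fourierChar (inner ℝ t ξ) : ℂ) - 1‖ * ‖g ξ‖) := by
          refine Continuous.mul (Continuous.norm (Continuous.sub ?_ continuous_const))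
            continuous_const
          exact continuous_subtype_val.comp (Real.continuous_fourierChar.comp (by fun_prop))
        simpa using hc.tendsto 0
    simpa using this
  refine ⟨?_, ⟨∫ ξ, ‖g ξ‖ ∂ν, fun x => ?_⟩, fun ε hε => ?_⟩
  · rw [Metric.uniformContinuous_iff]
    intro ε hε
    obtain ⟨δ, hδ, h⟩ := Metric.eventually_nhds_iff.1 (hN0.eventually_lt_const hε)
    refine ⟨δ, hδ, fun a b hab => ?_⟩
    have h1 := hdiff b (b - a)
    rw [sub_sub_cancel] at h1
    rw [dist_eq_norm]
    refine h1.trans_lt (h ?_)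
    rw [dist_zero_right, ← dist_eq_norm, dist_comm]
    exact hab
  · refine (norm_integral_le_integral_norm _).trans (le_of_eq ?_)
    refine integral_congr_ae (Eventually.of_forall fun ξ => ?_)
    simp only
    rw [norm_mul, Circle.norm_coe, one_mul]
  · -- finite truncation
    obtain ⟨e, he⟩ : ∃ e : ℕ → E, S ⊆ Set.range e := Set.countable_iff_exists_subset_range.1 hS
    let A : ℕ → Set E := fun n => (e '' Set.Iio n)ᶜ
    have hfin : ∀ n, (e '' Set.Iio n).Finite := fun n => (Set.finite_Iio n).image e
    have hAm : ∀ n, MeasurableSet (A n) := fun n => (hfin n).measurableSet.compl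
    have hAa : Antitone A := fun m n hmn =>
      Set.compl_subset_compl.2 (Set.image_mono (Set.Iio_subset_Iio hmn))
    have hAt : Tendsto (fun n => ∫ ξ in A n, ‖g ξ‖ ∂ν) atTop (𝓝 0) := by
      have h1 := hAa.tendsto_setIntegral (μ := ν) (f := fun ξ => ‖g ξ‖) hAm
        hg.norm.integrableOn
      have h2 : ν (⋂ n, A n) = 0 := by
        refine measure_mono_null ?_ hν
        intro ξ hξ hξS
        obtain ⟨k, rfl⟩ := he hξS
        exact (Set.mem_iInter.1 hξ (k + 1)) ⟨k, Nat.lt_succ_self k, rfl⟩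
      rwa [setIntegral_measure_zero _ h2] at h1
    obtain ⟨n, hn⟩ := (hAt.eventually_lt_const (show (0 : ℝ) < ε / 4 by positivity)).exists
    set G : ℝ := ∫ ξ, ‖g ξ‖ ∂ν with hG
    have hG0 : 0 ≤ G := integral_nonneg fun _ => norm_nonneg _
    let δ : ℝ := ε / (4 * (G + 1))
    have hδ : 0 < δ := by positivity
    obtain ⟨r, hr⟩ := relDense_finite_chars (hfin n).toFinset hδ
    refine ⟨r, fun x => ?_⟩
    obtain ⟨t, ht, hxt⟩ := hr x
    refine ⟨t, fun y => (hdiff y t).trans_lt ?_, hxt⟩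
    have hle : N t ≤ ∫ ξ, (δ * ‖g ξ‖ + (A n).indicator (fun ξ => 2 * ‖g ξ‖) ξ) ∂ν := by
      refine integral_mono (hNint t) ((hg.norm.const_mul δ).add
        ((hg.norm.const_mul 2).indicator (hAm n))) fun ξ => ?_
      by_cases hξ : ξ ∈ A n
      · simp only [Set.indicator_of_mem hξ]
        have := mul_le_mul_of_nonneg_right (hb2 t ξ) (norm_nonneg (g ξ))
        have h3 : 0 ≤ δ * ‖g ξ‖ := by positivity
        linarith
      · simp only [Set.indicator_of_notMem hξ, add_zero]
        refine mul_le_mul_of_nonneg_right (ht ξ ?_).le (norm_nonneg _)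
        simpa [A] using hξ
    rw [integral_add (hg.norm.const_mul δ) ((hg.norm.const_mul 2).indicator (hAm n)),
      integral_indicator (hAm n), integral_const_mul, integral_const_mul, ← hG] at hle
    have h4 : δ * G ≤ ε / 4 := by
      have : δ * (G + 1) = ε / 4 := by simp only [δ]; field_simp
      nlinarith
    linarith

end Aux

/-- The Fourier transform of a pure-point strongly tempered measure on
`ℝ^d` is strongly almost periodic as a tempered distribution. -/
theorem fourier_sapTD_of_stronglyTempered_purePoint (d : ℕ)
    (μ : CMeasure (EuclideanSpace ℝ (Fin d)))
    (T : SchwartzMap (EuclideanSpace ℝ (Fin d)) ℂ →L[ℂ] ℂ)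
    (hμT : μ.Agrees T)
    (hST : μ.IsStronglyTempered)
    (hpp : μ.IsPurePoint) :
    SAPTD (fourierTD T) := by

  intro ψ
  have := hST.hasTemperateGrowth
  obtain ⟨S, hS, hS0⟩ := hpp
  let g : SchwartzMap (EuclideanSpace ℝ (Fin d)) ℂ := FourierTransformInv.fourierInv ψ
  have h := isBohrAP_of_purePoint μ.tv S hS hS0 (fun ξ => g ξ * μ.density ξ)
    (μ.integrable_mul_density g)
  convert h using 1
  funext x
  simp only [convTD, fourierTD, ContinuousLinearMap.comp_apply]
  rw [hμT.eq_pairing, CMeasure.pairing]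
  refine integral_congr_ae (Eventually.of_forall fun ξ => ?_)
  simp only
  rw [fourier_transRefl, mul_assoc]
end
end
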